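/- arXiv:2402.09707 — 9 statements merged into one kernel-verified Lean document; each statement's English description precedes it below -/
import Mathlib

section
/- For every real number x with 0 ≤ x ≤ 1/5, one has exp(−x − x²) ≤ 1 − x. -/
/-- For every real number `x` with `0 ≤ x ≤ 1/5`, one has `exp (−x − x²) ≤ 1 − x`. -/
theorem exp_neg_add_sq_le_one_sub (x : ℝ) (hx0 : 0 ≤ x) (hx : x ≤ 1/5) :
    Real.exp (-x - x^2) ≤ 1 - x := by
  have hexp := Real.quadratic_le_exp_of_nonneg (show 0 ≤ x + x ^ 2 by positivity)
  have hx2 : x ^ 2 ≤ (1 / 5) ^ 2 := by gcongr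
  have hx3 : x ^ 3 ≤ (1 / 5) ^ 3 := by gcongr
  have hpoly : 1 ≤ (1 - x) * (1 + (x + x ^ 2) + (x + x ^ 2) ^ 2 / 2) := by
    have : 0 ≤ x ^ 2 / 2 * (1 - x - x ^ 2 - x ^ 3) :=
      mul_nonneg (by positivity) (by linarith)
    linarith
  rw [show -x - x ^ 2 = -(x + x ^ 2) by ring, Real.exp_neg,
    inv_le_iff_one_le_mul₀ (Real.exp_pos _)]
  exact hpoly.trans (mul_le_mul_of_nonneg_left hexp (by linarith))
end

section
/- Let d, k, n be positive integers with n ≥ 3. Let h : Fin k → Fin d be chosen uniformly at random (equivalently, h consists of k i.i.d. uniform draws from {1,…,d}). Then with probability at least 1 − 1/n³, the number of distinct values taken by h (the size of the image of h) is at least k − 7·(ln n)·max{1, k(k−1)/(2d)}. -/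
/-- Drawing one more coordinate multiplies the exponential of the number of collisions, on
average over that coordinate, by at most `exp (2 * k / d)`. -/
theorem sum_exp_collisions_insert_le {d : ℕ} (hd : 0 < d) (k : ℕ) (s : Finset (Fin d))
    (hs : s.card ≤ k) :
    ∑ a : Fin d, Real.exp (((k + 1 : ℕ) : ℝ) - ((insert a s).card : ℝ)) ≤
      d * Real.exp (2 * k / d) * Real.exp (k - s.card) := by
  have hd' : (0 : ℝ) < d := by exact_mod_cast hd
  have hs' : (s.card : ℝ) ≤ k := by exact_mod_cast hs
  have hterm (a : Fin d) : Real.exp (((k + 1 : ℕ) : ℝ) - ((insert a s).card : ℝ)) =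
      Real.exp (k - s.card) * (1 + if a ∈ s then Real.exp 1 - 1 else 0) := by
    split_ifs with ha
    · rw [Finset.insert_eq_of_mem ha, add_sub_cancel, ← Real.exp_add]
      push_cast
      ring_nf
    · rw [Finset.card_insert_of_notMem ha]
      push_cast
      ring_nf
  have hsum : ∑ a : Fin d, (1 + if a ∈ s then Real.exp 1 - 1 else 0) =
      d + s.card * (Real.exp 1 - 1) := by
    simp [Finset.sum_add_distrib, mul_sub]
  rw [Finset.sum_congr rfl fun a _ => hterm a, ← Finset.mul_sum, hsum, mul_comm]
  gcongr
  calc (d : ℝ) + s.card * (Real.exp 1 - 1) ≤ d + k * 2 := by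
        gcongr
        · linarith [Real.exp_one_gt_d9]
        · linarith [Real.exp_one_lt_d9]
    _ = d * (2 * k / d + 1) := by field_simp; ring
    _ ≤ d * Real.exp (2 * k / d) := by gcongr; exact Real.add_one_le_exp _

/-- Exponential moment bound for the number `k - |image h|` of collisions of a tuple. -/
theorem sum_exp_collisions_le {d : ℕ} (hd : 0 < d) (k : ℕ) :
    ∑ h : Fin k → Fin d, Real.exp (k - (Finset.image h Finset.univ).card) ≤
      (d : ℝ) ^ k * Real.exp (k * (k - 1) / d) := by
  induction k with
  | zero => simp
  | succ k ih =>
    rw [← (Fin.consEquiv fun _ : Fin (k + 1) => Fin d).sum_comp, Fintype.sum_prod_type_right]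
    have himage (a : Fin d) (h : Fin k → Fin d) :
        Finset.image (Fin.consEquiv (fun _ : Fin (k + 1) => Fin d) (a, h)) Finset.univ =
          insert a (Finset.image h Finset.univ) := by
      ext x
      simp [Fin.exists_fin_succ, Fin.consEquiv, eq_comm]
    simp only [himage]
    calc _ ≤ ∑ h : Fin k → Fin d, d * Real.exp (2 * k / d) *
          Real.exp (k - (Finset.image h Finset.univ).card) :=
          Finset.sum_le_sum fun h _ => sum_exp_collisions_insert_le hd k _
            (Finset.card_image_le.trans (by simp))
      _ ≤ d * Real.exp (2 * k / d) * ((d : ℝ) ^ k * Real.exp (k * (k - 1) / d)) := by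
          rw [← Finset.mul_sum]
          gcongr
      _ = (d : ℝ) ^ (k + 1) * (Real.exp (2 * k / d) * Real.exp (k * (k - 1) / d)) := by ring
      _ = _ := by
          rw [← Real.exp_add]
          push_cast
          ring_nf

/-- For a uniformly random tuple `h : Fin k → Fin d` (i.e. `k` i.i.d. uniform draws from
`{1,…,d}`), with probability at least `1 − 1/n³` the size of the image of `h` is at least
`k − 7·ln n·max{1, k(k−1)/(2d)}`. -/
theorem support_size_single_hash (d k n : ℕ) (hd : 0 < d) (hk : 0 < k) (hn : 3 ≤ n) :
    (1 : ℝ) - 1 / (n : ℝ)^3 ≤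
      ((Finset.univ.filter (fun h : Fin k → Fin d =>
          (k : ℝ) - 7 * Real.log n * max 1 ((k : ℝ) * ((k : ℝ) - 1) / (2 * d))
            ≤ ((Finset.image h Finset.univ).card : ℝ))).card : ℝ)
        / (Fintype.card (Fin k → Fin d) : ℝ) := by
  have hd' : (0 : ℝ) < d := by exact_mod_cast hd
  have hn' : (3 : ℝ) ≤ n := by exact_mod_cast hn
  have hn0 : (0 : ℝ) < n := by linarith
  have hlog : 1 ≤ Real.log n := by
    rw [Real.le_log_iff_exp_le hn0]
    linarith [Real.exp_one_lt_d9]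
  set M : ℝ := max 1 ((k : ℝ) * ((k : ℝ) - 1) / (2 * d)) with hM
  have hM1 : 1 ≤ M := le_max_left _ _
  have hMμ : (k : ℝ) * (k - 1) / d ≤ 2 * M := by
    have h : (k : ℝ) * (k - 1) / (2 * d) ≤ M := le_max_right _ _
    calc (k : ℝ) * (k - 1) / d = 2 * ((k : ℝ) * (k - 1) / (2 * d)) := by field_simp
      _ ≤ 2 * M := by gcongr
  set p : (Fin k → Fin d) → Prop := fun h =>
    (k : ℝ) - 7 * Real.log n * M ≤ ((Finset.image h Finset.univ).card : ℝ) with hp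
  set bad : ℝ := ((Finset.univ.filter fun h => ¬ p h).card : ℝ) with hbad
  have hcard : (Fintype.card (Fin k → Fin d) : ℝ) = (d : ℝ) ^ k := by simp
  have hsplit : ((Finset.univ.filter p).card : ℝ) + bad = (d : ℝ) ^ k := by
    rw [← hcard, hbad]
    exact_mod_cast Finset.card_filter_add_card_filter_not (s := Finset.univ) p
  have hmarkov : bad * Real.exp (7 * Real.log n * M) ≤ (d : ℝ) ^ k * Real.exp (2 * M) := by
    calc bad * Real.exp (7 * Real.log n * M)
        = ∑ h with ¬ p h, Real.exp (7 * Real.log n * M) := by simp [hbad]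
      _ ≤ ∑ h with ¬ p h, Real.exp (k - (Finset.image h Finset.univ).card) := by
          refine Finset.sum_le_sum fun h hh => Real.exp_le_exp.mpr ?_
          have := not_le.mp (Finset.mem_filter.mp hh).2
          linarith
      _ ≤ ∑ h : Fin k → Fin d, Real.exp (k - (Finset.image h Finset.univ).card) :=
          Finset.sum_le_sum_of_subset_of_nonneg (Finset.filter_subset _ _)
            fun _ _ _ => (Real.exp_pos _).le
      _ ≤ (d : ℝ) ^ k * Real.exp (k * (k - 1) / d) := sum_exp_collisions_le hd k
      _ ≤ (d : ℝ) ^ k * Real.exp (2 * M) := by gcongr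
  have hpow : (n : ℝ) ^ 3 = Real.exp (3 * Real.log n) := by
    rw [mul_comm, Real.exp_mul, Real.exp_log hn0]
    norm_cast
  have hexp : Real.exp (2 * M) * (n : ℝ) ^ 3 ≤ Real.exp (7 * Real.log n * M) := by
    rw [hpow, ← Real.exp_add]
    gcongr
    nlinarith
  have hbound : bad * (n : ℝ) ^ 3 ≤ (d : ℝ) ^ k := by
    have hbad0 : 0 ≤ bad := Nat.cast_nonneg _
    refine le_of_mul_le_mul_right ?_ (Real.exp_pos (2 * M))
    calc bad * (n : ℝ) ^ 3 * Real.exp (2 * M) = bad * (Real.exp (2 * M) * (n : ℝ) ^ 3) := by ring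
      _ ≤ bad * Real.exp (7 * Real.log n * M) := by gcongr
      _ ≤ _ := hmarkov
  rw [hcard, le_div_iff₀ (by positivity), sub_mul, one_mul, one_div_mul_eq_div]
  have : bad ≤ (d : ℝ) ^ k / (n : ℝ) ^ 3 := (le_div_iff₀ (by positivity)).mpr hbound
  linarith
end

section
/- Let n, d, r be positive integers with n ≥ 3 and r ≥ 1, and let c ≥ 1 and 0 < λ ≤ n be reals with r ≤ c·r < d. Set ρ = ln(1 − r/d)/ln(1 − c·r/d) and L = ⌈λ·n^ρ⌉, and let G : Fin L → (Fin k → Fin d) be a family of L hash functions whose L·k coordinate indices are i.i.d. uniform in {1,…,d}. Then with probability at least 1 − 1/n, every hash function G j has support size at least k − 7·(ln n)·max{1, k²/(2d)}. -/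
/-- The expectation of `2 ^ (k - #(image h))` over a uniformly random `h : Fin k → Fin d` is at most
`exp (k ^ 2 / (2 * d))`. -/
lemma sum_two_pow_mul_half_pow_card_image_le (d : ℕ) (hd : 0 < d) (k : ℕ) :
    ∑ h : Fin k → Fin d, (2 : ℝ) ^ k * (1 / 2) ^ (Finset.image h Finset.univ).card
      ≤ (d : ℝ) ^ k * Real.exp ((k : ℝ) ^ 2 / (2 * d)) := by
  have hd' : (0 : ℝ) < d := by exact_mod_cast hd
  induction k with
  | zero => simp
  | succ k ih =>
    have image_cons (a : Fin d) (h : Fin k → Fin d) :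
        Finset.image (Fin.cons a h : Fin (k + 1) → Fin d) Finset.univ
          = insert a (Finset.image h Finset.univ) := by
      ext x
      simp [Fin.exists_fin_succ, eq_comm]
    have weight_cons (a : Fin d) (h : Fin k → Fin d) :
        (2 : ℝ) ^ (k + 1) * (1 / 2) ^ (insert a (Finset.image h Finset.univ)).card
          = 2 ^ k * (1 / 2) ^ (Finset.image h Finset.univ).card
            * (1 + if a ∈ Finset.image h Finset.univ then 1 else 0) := by
      split_ifs with ha
      · rw [Finset.insert_eq_of_mem ha]
        ring
      · rw [Finset.card_insert_of_notMem ha]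
        ring
    rw [← (Fin.consEquiv fun _ : Fin (k + 1) => Fin d).sum_comp, Fintype.sum_prod_type_right]
    calc ∑ h : Fin k → Fin d, ∑ a : Fin d, (2 : ℝ) ^ (k + 1)
            * (1 / 2) ^ (Finset.image (Fin.cons a h : Fin (k + 1) → Fin d) Finset.univ).card
        = ∑ h : Fin k → Fin d, 2 ^ k * (1 / 2) ^ (Finset.image h Finset.univ).card
            * ((d : ℝ) + (Finset.image h Finset.univ).card) := by
          refine Finset.sum_congr rfl fun h _ => ?_
          simp_rw [image_cons, weight_cons, ← Finset.mul_sum, Finset.sum_add_distrib]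
          simp only [Finset.sum_ite_mem, Finset.univ_inter]
          simp
      _ ≤ ∑ h : Fin k → Fin d, 2 ^ k * (1 / 2) ^ (Finset.image h Finset.univ).card
            * ((d : ℝ) + k) := by
          gcongr with h
          exact Finset.card_image_le.trans (by simp)
      _ ≤ (d : ℝ) ^ k * Real.exp ((k : ℝ) ^ 2 / (2 * d)) * (d + k) := by
          rw [← Finset.sum_mul]
          gcongr
      _ = (d : ℝ) ^ (k + 1) * (Real.exp ((k : ℝ) ^ 2 / (2 * d)) * (k / d + 1)) := by
          field_simp
          ring
      _ ≤ (d : ℝ) ^ (k + 1) * (Real.exp ((k : ℝ) ^ 2 / (2 * d)) * Real.exp (k / d)) := by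
          gcongr
          exact Real.add_one_le_exp _
      _ ≤ (d : ℝ) ^ (k + 1) * Real.exp (((k + 1 : ℕ) : ℝ) ^ 2 / (2 * d)) := by
          rw [← Real.exp_add]
          gcongr
          push_cast
          rw [div_add_div _ _ (by positivity) hd'.ne',
            div_le_div_iff₀ (by positivity) (by positivity)]
          nlinarith [mul_pos hd' hd']

/-- Chernoff bound: few `h : Fin k → Fin d` have more than `t` collisions. -/
lemma card_filter_card_image_lt_le (d : ℕ) (hd : 0 < d) (k : ℕ) (t : ℝ) :
    ((Finset.univ.filter fun h : Fin k → Fin d =>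
        ((Finset.image h Finset.univ).card : ℝ) < k - t).card : ℝ)
      ≤ (d : ℝ) ^ k * Real.exp ((k : ℝ) ^ 2 / (2 * d) - Real.log 2 * t) := by
  have weight_ge (h : Fin k → Fin d) (hh : ((Finset.image h Finset.univ).card : ℝ) < k - t) :
      Real.exp (Real.log 2 * t)
        ≤ (2 : ℝ) ^ k * (1 / 2) ^ (Finset.image h Finset.univ).card := by
    have key : (2 : ℝ) ^ k * (1 / 2) ^ (Finset.image h Finset.univ).card
        = Real.exp (Real.log 2 * (k - (Finset.image h Finset.univ).card)) := by
      rw [mul_sub, Real.exp_sub, mul_comm (Real.log 2), mul_comm (Real.log 2), Real.exp_nat_mul,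
        Real.exp_nat_mul, Real.exp_log two_pos, one_div, inv_pow, div_eq_mul_inv]
    rw [key]
    have := Real.log_pos one_lt_two
    gcongr
    linarith
  rw [Real.exp_sub, ← mul_div_assoc, le_div_iff₀ (Real.exp_pos _), ← nsmul_eq_mul]
  calc _ ≤ ∑ h ∈ Finset.univ.filter fun h : Fin k → Fin d =>
          ((Finset.image h Finset.univ).card : ℝ) < k - t,
          (2 : ℝ) ^ k * (1 / 2) ^ (Finset.image h Finset.univ).card :=
        Finset.card_nsmul_le_sum _ _ _ fun h hh => weight_ge h (Finset.mem_filter.1 hh).2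
    _ ≤ ∑ h : Fin k → Fin d, (2 : ℝ) ^ k * (1 / 2) ^ (Finset.image h Finset.univ).card :=
        Finset.sum_le_sum_of_subset_of_nonneg (Finset.filter_subset _ _)
          fun _ _ _ => by positivity
    _ ≤ _ := sum_two_pow_mul_half_pow_card_image_le d hd k

lemma log_one_sub_div_log_one_sub_le_one {x y : ℝ} (hx : 0 < x) (hxy : x ≤ y) (hy : y < 1) :
    Real.log (1 - x) / Real.log (1 - y) ≤ 1 := by
  rw [div_le_one_of_neg (Real.log_neg (by linarith) (by linarith))]
  exact Real.log_le_log (by linarith) (by linarith)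

/-- If a predicate fails for at most a fraction `ε` of the elements of `α`, then it holds for all
entries of at least a fraction `1 - m * ε` of the families `Fin m → α`. -/
lemma one_sub_mul_le_card_filter_forall_div {α : Type*} [Fintype α] [Nonempty α]
    [DecidableEq α] (p : α → Prop) [DecidablePred p] (m : ℕ)
    [DecidablePred fun G : Fin m → α => ∀ j, p (G j)] {ε : ℝ} (hε : ε ≤ 1)
    (hp : ((Finset.univ.filter fun a => ¬ p a).card : ℝ) ≤ Fintype.card α * ε) :
    1 - m * ε ≤ ((Finset.univ.filter fun G : Fin m → α => ∀ j, p (G j)).card : ℝ)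
      / (Fintype.card (Fin m → α) : ℝ) := by
  have hα : (0 : ℝ) < Fintype.card α := by exact_mod_cast Fintype.card_pos
  have hfilter : (Finset.univ.filter fun G : Fin m → α => ∀ j, p (G j))
      = Fintype.piFinset fun _ => Finset.univ.filter p := by
    ext G
    simp
  have hsum : ((Finset.univ.filter p).card : ℝ) + (Finset.univ.filter fun a => ¬ p a).card
      = Fintype.card α := by
    exact_mod_cast Finset.card_filter_add_card_filter_not (s := Finset.univ) p
  rw [hfilter, Fintype.card_piFinset_const, Fintype.card_fun, Fintype.card_fin]
  push_cast
  rw [← div_pow]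
  calc 1 - m * ε = 1 + m * (-ε) := by ring
    _ ≤ (1 + -ε) ^ m := one_add_mul_le_pow (by linarith) m
    _ ≤ _ := by
      gcongr
      · linarith
      · rw [le_div_iff₀ hα]
        linarith


/-- For a uniformly random family `G : Fin L → (Fin k → Fin d)` of `L = ⌈λ·n^ρ⌉` hash
functions (all `L·k` coordinate indices i.i.d. uniform in `{1,…,d}`), with probability at
least `1 − 1/n`, every hash function `G j` has support size at least
`k − 7·ln n·max{1, k²/(2d)}`. -/
theorem support_size_all_hashes (n d r k : ℕ) (hn : 3 ≤ n) (hd : 0 < d) (hr : 1 ≤ r)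
    (hk : 0 < k) (c lam : ℝ) (hc : 1 ≤ c) (hlam0 : 0 < lam) (hlamn : lam ≤ n)
    (hrcr : (r : ℝ) ≤ c * r) (hcrd : c * r < d)
    (L : ℕ)
    (hL : L = ⌈lam * (n : ℝ) ^ (Real.log (1 - (r : ℝ) / d) / Real.log (1 - c * r / d))⌉₊) :
    (1 : ℝ) - 1 / (n : ℝ) ≤
      ((Finset.univ.filter (fun G : Fin L → Fin k → Fin d =>
          ∀ j : Fin L,
            (k : ℝ) - 7 * Real.log n * max 1 ((k : ℝ)^2 / (2 * d))
              ≤ ((Finset.image (G j) Finset.univ).card : ℝ))).card : ℝ)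
        / (Fintype.card (Fin L → Fin k → Fin d) : ℝ) := by
  have hd' : (0 : ℝ) < d := by exact_mod_cast hd
  have hr' : (1 : ℝ) ≤ r := by exact_mod_cast hr
  have hn' : (3 : ℝ) ≤ n := by exact_mod_cast hn
  have hn0 : (0 : ℝ) < n := by linarith
  have : NeZero d := ⟨hd.ne'⟩
  have hρ := log_one_sub_div_log_one_sub_le_one (x := (r : ℝ) / d) (y := c * r / d)
    (by positivity) (by gcongr) ((div_lt_one hd').2 hcrd)
  have hLn : (L : ℝ) ≤ (n : ℝ) ^ 2 := by
    have : L ≤ n ^ 2 := by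
      rw [hL]
      refine Nat.ceil_le.2 ?_
      push_cast
      rw [sq]
      gcongr
      exact (Real.rpow_le_rpow_of_exponent_le (by linarith) hρ).trans_eq (Real.rpow_one _)
    exact_mod_cast this
  have hlog : 1 ≤ Real.log n := by
    rw [Real.le_log_iff_exp_le hn0]
    linarith [Real.exp_one_lt_d9]
  set M := max 1 ((k : ℝ) ^ 2 / (2 * d))
  have hM1 : 1 ≤ M := le_max_left _ _
  have hμM : (k : ℝ) ^ 2 / (2 * d) ≤ M := le_max_right _ _
  have hexp : Real.exp ((k : ℝ) ^ 2 / (2 * d) - Real.log 2 * (7 * Real.log n * M))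
      ≤ 1 / (n : ℝ) ^ 3 := by
    have : 1 / (n : ℝ) ^ 3 = Real.exp (-(3 * Real.log n)) := by
      rw [Real.exp_neg, one_div, show (3 : ℝ) = ((3 : ℕ) : ℝ) by norm_num, Real.exp_nat_mul,
        Real.exp_log hn0]
    rw [this]
    gcongr
    have hlM : Real.log n ≤ Real.log n * M := le_mul_of_one_le_right (by linarith) hM1
    have hMl : M ≤ Real.log n * M := le_mul_of_one_le_left (by linarith) hlog
    nlinarith [Real.log_two_gt_d9]
  have hbad := (card_filter_card_image_lt_le d hd k (7 * Real.log n * M)).trans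
    (mul_le_mul_of_nonneg_left hexp (by positivity))
  calc 1 - 1 / (n : ℝ) = 1 - (n : ℝ) ^ 2 * (1 / (n : ℝ) ^ 3) := by field_simp
    _ ≤ 1 - L * (1 / (n : ℝ) ^ 3) := by gcongr
    _ ≤ _ := by
      refine one_sub_mul_le_card_filter_forall_div (fun h : Fin k → Fin d =>
        (k : ℝ) - 7 * Real.log n * M ≤ ((Finset.image h Finset.univ).card : ℝ)) L ?_ ?_
      · exact (div_le_one (by positivity)).2 (one_le_pow₀ (by linarith))
      · simpa only [not_le, Fintype.card_fun, Fintype.card_fin, Nat.cast_pow] using hbad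
end

section
/- Let n, d, r be positive integers with n ≥ 3 and let c ≥ 1, λ > 0 be reals such that c·r is a positive integer and: 8e²(λ+1)·ln n ≤ c·r, 28·(ln n)³/c² ≤ r, r ≤ d/(14·ln n), r ≤ d/(5c), and c < ln n. Set p₂ = 1 − c·r/d, k = ⌈ln n/(−ln p₂)⌉, ρ = ln(1 − r/d)/ln(1 − c·r/d), L = ⌈λ·n^ρ⌉, t = 2e²(λ+1), and x = 7·(ln n)·max{1, k²/(2d)}. Let z be a point of the d-dimensional Hamming cube and let G : Fin L → (Fin k → Fin d) be any family of hash functions each of which has support size at least k − x. Let s be a natural number with r − t ≤ s ≤ r, and let q be drawn uniformly at random from the points at Hamming distance s from z. Then the expected size of Coll(q, z) is at most e²·(λ+1). -/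
/-- The points at Hamming distance `s` from `z` that agree with `z` on `U` correspond to the
`s`-element subsets of the complement of `U`. -/
theorem card_hammingSphere_agree {ι : Type*} [Fintype ι] [DecidableEq ι] (z : ι → Bool)
    (U : Finset ι) (s : ℕ) :
    (Finset.univ.filter (fun q : ι → Bool => hammingDist q z = s ∧ ∀ i ∈ U, q i = z i)).card
      = (Fintype.card ι - U.card).choose s := by
  rw [← Finset.card_compl, ← Finset.card_powersetCard]
  refine Finset.card_nbij' (fun q => Finset.univ.filter (fun i => q i ≠ z i))
    (fun S i => if i ∈ S then !(z i) else z i) ?_ ?_ ?_ ?_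
  · intro q hq
    simp only [Finset.coe_filter, Finset.mem_univ, true_and, Set.mem_ofPred_eq] at hq
    simp only [Finset.mem_coe, Finset.mem_powersetCard]
    refine ⟨fun i hi => ?_, hq.1⟩
    simp only [Finset.mem_filter, Finset.mem_univ, true_and] at hi
    exact Finset.mem_compl.2 fun hU => hi (hq.2 i hU)
  · intro S hS
    simp only [Finset.mem_coe, Finset.mem_powersetCard] at hS
    simp only [Finset.coe_filter, Finset.mem_univ, true_and, Set.mem_ofPred_eq]
    refine ⟨?_, fun i hi => if_neg fun hiS => Finset.mem_compl.1 (hS.1 hiS) hi⟩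
    rw [← hS.2, hammingDist]
    congr 1
    ext i
    by_cases hi : i ∈ S <;> simp [hi]
  · intro q _
    funext i
    by_cases hi : q i = z i
    · simp [hi]
    · simpa [hi] using (Bool.eq_not_of_ne hi).symm
  · intro S _
    ext i
    by_cases hi : i ∈ S <;> simp [hi]

theorem card_hammingSphere {ι : Type*} [Fintype ι] [DecidableEq ι] (z : ι → Bool) (s : ℕ) :
    (Finset.univ.filter (fun q : ι → Bool => hammingDist q z = s)).card
      = (Fintype.card ι).choose s := by
  simpa using card_hammingSphere_agree z ∅ s

theorem choose_sub_le_pow_mul_choose {d s : ℕ} (hs : s ≤ d) (u : ℕ) (hu : u ≤ d) :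
    ((d - u).choose s : ℝ) ≤ (1 - (s : ℝ) / d) ^ u * (d.choose s : ℝ) := by
  induction u with
  | zero => simp
  | succ u ih =>
    obtain ⟨m, rfl⟩ : ∃ m, d = m + 1 + u := ⟨d - (u + 1), by omega⟩
    have ih := ih (by omega)
    rw [show m + 1 + u - u = m + 1 by omega] at ih
    rw [show m + 1 + u - (u + 1) = m by omega]
    set D : ℕ := m + 1 + u with hD
    have hD0 : (0 : ℝ) < D := by positivity
    have hsD : (s : ℝ) / D ≤ 1 := (div_le_one hD0).2 (by exact_mod_cast hs)
    rcases lt_or_ge m s with hms | hms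
    · rw [Nat.choose_eq_zero_of_lt hms, Nat.cast_zero]
      have : (0 : ℝ) ≤ 1 - s / D := by linarith
      positivity
    · have hrec : (m.choose s : ℝ) = (1 - (s : ℝ) / (m + 1)) * ((m + 1).choose s : ℝ) := by
        have h := congrArg (Nat.cast : ℕ → ℝ) (Nat.choose_mul_succ_eq m s)
        rw [Nat.cast_mul, Nat.cast_mul, Nat.cast_sub (by omega)] at h
        push_cast at h
        have hm : (m : ℝ) + 1 ≠ 0 := by positivity
        field_simp
        linarith
      have hle : 1 - (s : ℝ) / (m + 1) ≤ 1 - (s : ℝ) / D := by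
        have : (m : ℝ) + 1 ≤ D := by rw [hD]; push_cast; linarith [Nat.cast_nonneg (α := ℝ) u]
        gcongr
      calc (m.choose s : ℝ) = (1 - (s : ℝ) / (m + 1)) * ((m + 1).choose s : ℝ) := hrec
        _ ≤ (1 - (s : ℝ) / D) * ((m + 1).choose s : ℝ) := by gcongr
        _ ≤ (1 - (s : ℝ) / D) * ((1 - (s : ℝ) / D) ^ u * (D.choose s : ℝ)) :=
          mul_le_mul_of_nonneg_left ih (by linarith)
        _ = (1 - (s : ℝ) / D) ^ (u + 1) * (D.choose s : ℝ) := by ring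

/-- If every hash function collides with probability at most `ε` on the sphere, then the expected
number of collisions is at most `L * ε`. -/
theorem expected_collisions_le {d k L s : ℕ} (hs : s ≤ d) (z : Fin d → Bool)
    (G : Fin L → Fin k → Fin d) {ε : ℝ}
    (hε : ∀ j, (1 - (s : ℝ) / d) ^ (Finset.image (G j) Finset.univ).card ≤ ε) :
    (∑ q ∈ Finset.univ.filter (fun q : Fin d → Bool => hammingDist q z = s),
        ((Finset.univ.filter (fun j : Fin L =>
            ∀ m : Fin k, q (G j m) = z (G j m))).card : ℝ))
      / ((Finset.univ.filter (fun q : Fin d → Bool => hammingDist q z = s)).card : ℝ)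
      ≤ L * ε := by
  have hpos : (0 : ℝ) < (d.choose s : ℝ) := by exact_mod_cast Nat.choose_pos hs
  have hswap := Finset.sum_card_bipartiteAbove_eq_sum_card_bipartiteBelow
    (s := Finset.univ.filter (fun q : Fin d → Bool => hammingDist q z = s)) (t := Finset.univ)
    (fun (q : Fin d → Bool) (j : Fin L) => ∀ m : Fin k, q (G j m) = z (G j m))
  unfold Finset.bipartiteAbove at hswap
  rw [card_hammingSphere, Fintype.card_fin, div_le_iff₀ hpos, ← Nat.cast_sum, hswap]
  push_cast
  calc _ ≤ ∑ _j : Fin L, ε * (d.choose s : ℝ) := by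
        refine Finset.sum_le_sum fun j _ => ?_
        have hcard : (Finset.bipartiteBelow
            (fun (q : Fin d → Bool) (j : Fin L) => ∀ m : Fin k, q (G j m) = z (G j m))
            (Finset.univ.filter (fun q : Fin d → Bool => hammingDist q z = s)) j).card
            = (d - (Finset.image (G j) Finset.univ).card).choose s := by
          have h := card_hammingSphere_agree z (Finset.image (G j) Finset.univ) s
          rw [Fintype.card_fin] at h
          rw [← h, Finset.bipartiteBelow, Finset.filter_filter]
          simp
        rw [hcard]
        have hu : (Finset.image (G j) Finset.univ).card ≤ d := by
          simpa using Finset.card_le_univ (Finset.image (G j) Finset.univ)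
        refine (choose_sub_le_pow_mul_choose hs _ hu).trans ?_
        exact mul_le_mul_of_nonneg_right (hε j) hpos.le
    _ = L * ε * (d.choose s : ℝ) := by simp [mul_assoc]

/-- The exponent lost by passing from `r` to `s` and from `k` to `k - x` is at most `2`. -/
theorem exponent_loss_le_two {l c r d k s t : ℝ} (hl : 1 ≤ l) (hc : 1 ≤ c) (hr : 0 < r)
    (hd : 0 < d) (hk0 : 0 ≤ k) (hkle : k ≤ d * l / (c * r) + 1) (h1 : 4 * t * l ≤ c * r)
    (h2 : 28 * l ^ 3 / c ^ 2 ≤ r) (h3 : 14 * l * r ≤ d) (h4 : 5 * c * r ≤ d)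
    (hsr : s ≤ r) (hst : r - s ≤ t) :
    (-Real.log (1 - r / d)) * k
      - (-Real.log (1 - s / d)) * (k - 7 * l * max 1 (k ^ 2 / (2 * d))) ≤ 2 := by
  have hcr : 0 < c * r := by positivity
  have hrd : 14 * r ≤ d := by nlinarith
  have hdr : 0 < d - r := by linarith
  have hds : 0 < d - s := by linarith
  have hR : 1 - r / d = (d - r) / d := by field_simp
  have hS : 1 - s / d = (d - s) / d := by field_simp
  have hlogs : -Real.log (1 - r / d) - -Real.log (1 - s / d) ≤ t / (d - r) := by
    rw [hR, hS, Real.log_div hdr.ne' hd.ne', Real.log_div hds.ne' hd.ne']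
    have := Real.log_le_sub_one_of_pos (div_pos hds hdr)
    rw [Real.log_div hds.ne' hdr.ne'] at this
    have h : (d - s) / (d - r) - 1 = (r - s) / (d - r) := by field_simp; ring
    have : (r - s) / (d - r) ≤ t / (d - r) := by gcongr
    linarith
  have hloga : -Real.log (1 - s / d) ≤ r / (d - r) := by
    rw [hS, ← Real.log_inv, inv_div]
    have := Real.log_le_sub_one_of_pos (div_pos hd hds)
    have h : d / (d - s) - 1 = s / (d - s) := by field_simp; ring
    have : s / (d - s) ≤ r / (d - r) := by gcongr
    linarith
  have hkcr : k * (c * r) ≤ d * l + c * r := by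
    calc k * (c * r) ≤ (d * l / (c * r) + 1) * (c * r) := by gcongr
      _ = d * l + c * r := by field_simp
  have hkt : k * t ≤ 3 / 10 * d := by
    have h : k * t * (4 * l) ≤ 3 / 10 * d * (4 * l) := by nlinarith
    exact le_of_mul_le_mul_right h (by positivity)
  have hfirst : t / (d - r) * k ≤ 1 := by
    rw [div_mul_eq_mul_div, div_le_one hdr]
    linarith
  have hsecond : r / (d - r) * (7 * l * max 1 (k ^ 2 / (2 * d))) ≤ 1 := by
    rw [div_mul_eq_mul_div, div_le_one hdr]
    rcases max_choice 1 (k ^ 2 / (2 * d)) with h | h <;> rw [h]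
    · linarith
    · have hk2 : k * (c * r) ≤ 6 / 5 * (d * l) := by nlinarith
      have hsq : (k * (c * r)) ^ 2 ≤ (6 / 5 * (d * l)) ^ 2 := by gcongr
      have hl3 : 28 * l ^ 3 ≤ r * c ^ 2 := by rwa [div_le_iff₀ (by positivity)] at h2
      have hmain : 7 * l * k ^ 2 * r ≤ d ^ 2 := by
        have : 7 * l * k ^ 2 * r * (c ^ 2 * r) ≤ d ^ 2 * (c ^ 2 * r) := by
          calc 7 * l * k ^ 2 * r * (c ^ 2 * r) = 7 * l * (k * (c * r)) ^ 2 := by ring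
            _ ≤ 7 * l * (6 / 5 * (d * l)) ^ 2 := by gcongr
            _ = 9 / 25 * d ^ 2 * (28 * l ^ 3) := by ring
            _ ≤ 9 / 25 * d ^ 2 * (r * c ^ 2) := by gcongr
            _ ≤ 1 * d ^ 2 * (r * c ^ 2) := by gcongr; norm_num
            _ = d ^ 2 * (c ^ 2 * r) := by ring
        exact le_of_mul_le_mul_right this (by positivity)
      have : r * (7 * l * (k ^ 2 / (2 * d))) = 7 * l * k ^ 2 * r / (2 * d) := by ring
      rw [this, div_le_iff₀ (by positivity)]
      nlinarith
  have hx0 : 0 ≤ 7 * l * max 1 (k ^ 2 / (2 * d)) := by positivity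
  have e1 := mul_le_mul_of_nonneg_right hlogs hk0
  have e2 := mul_le_mul_of_nonneg_right hloga hx0
  linarith


/-- Lemma 4.3 of the paper: under the stated parameter assumptions, if every hash function
in the family `G` has support size at least `k − x` with
`x = 7·ln n·max{1, k²/(2d)}`, and `q` is drawn uniformly at random from the Hamming sphere
of radius `s` around `z` with `r − t ≤ s ≤ r` for `t = 2e²(λ+1)`, then the expected size of
`Coll(q, z)` is at most `e²·(λ+1)`. -/
theorem expected_collisions_near (n d r : ℕ) (hn : 3 ≤ n) (hd : 0 < d) (hr : 0 < r)
    (c lam : ℝ) (hc : 1 ≤ c) (hlam : 0 < lam)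
    (cr : ℕ) (hcr0 : 0 < cr) (hcrval : (cr : ℝ) = c * r)
    (h1 : 8 * Real.exp 2 * (lam + 1) * Real.log n ≤ c * r)
    (h2 : 28 * (Real.log n)^3 / c^2 ≤ (r : ℝ))
    (h3 : (r : ℝ) ≤ d / (14 * Real.log n))
    (h4 : (r : ℝ) ≤ d / (5 * c))
    (h5 : c < Real.log n)
    (k L : ℕ)
    (hk : k = ⌈Real.log n / (-Real.log (1 - c * r / d))⌉₊)
    (hL : L = ⌈lam * (n : ℝ) ^ (Real.log (1 - (r : ℝ) / d) / Real.log (1 - c * r / d))⌉₊)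
    (z : Fin d → Bool)
    (G : Fin L → Fin k → Fin d)
    (hG : ∀ j : Fin L,
        (k : ℝ) - 7 * Real.log n * max 1 ((k : ℝ)^2 / (2 * d))
          ≤ ((Finset.image (G j) Finset.univ).card : ℝ))
    (s : ℕ)
    (hs1 : (r : ℝ) - 2 * Real.exp 2 * (lam + 1) ≤ (s : ℝ))
    (hs2 : s ≤ r) :
    (∑ q ∈ Finset.univ.filter (fun q : Fin d → Bool => hammingDist q z = s),
        ((Finset.univ.filter (fun j : Fin L =>
            ∀ m : Fin k, q (G j m) = z (G j m))).card : ℝ))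
      / ((Finset.univ.filter (fun q : Fin d → Bool => hammingDist q z = s)).card : ℝ)
      ≤ Real.exp 2 * (lam + 1) := by
  have hn' : (3 : ℝ) ≤ n := by exact_mod_cast hn
  have hl : 1 ≤ Real.log n := by
    rw [Real.le_log_iff_exp_le (by linarith)]
    linarith [Real.exp_one_lt_d9]
  set l := Real.log n with hl_def
  have hd' : (0 : ℝ) < d := by exact_mod_cast hd
  have hr' : (0 : ℝ) < r := by exact_mod_cast hr
  have hs2' : (s : ℝ) ≤ r := by exact_mod_cast hs2
  have hcr : 0 < c * r := by positivity
  have h3' : 14 * l * r ≤ d := by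
    rw [le_div_iff₀ (by positivity)] at h3
    linarith
  have h4' : 5 * c * r ≤ d := by
    rw [le_div_iff₀ (by positivity)] at h4
    linarith
  have hrd : 14 * (r : ℝ) ≤ d := by nlinarith
  have hp2 : c * r / d ≤ 1 / 5 := by
    rw [div_le_iff₀ hd']
    linarith
  have hlogp : c * r / d ≤ -Real.log (1 - c * r / d) := by
    have := Real.log_le_sub_one_of_pos (show 0 < 1 - c * r / d by linarith)
    linarith
  have hlogp0 : 0 < -Real.log (1 - c * r / d) := lt_of_lt_of_le (by positivity) hlogp
  have hrd1 : (r : ℝ) / d < 1 := (div_lt_one hd').2 (by linarith)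
  have hsd1 : (s : ℝ) / d < 1 := (div_lt_one hd').2 (by linarith)
  set a := -Real.log (1 - (s : ℝ) / d) with ha
  set b := -Real.log (1 - (r : ℝ) / d) with hb
  have ha0 : 0 ≤ a := by
    have := Real.log_nonpos (show 0 ≤ 1 - (s : ℝ) / d by linarith)
      (by linarith [show 0 ≤ (s : ℝ) / d by positivity])
    linarith
  have hb0 : 0 ≤ b := by
    have := Real.log_nonpos (show 0 ≤ 1 - (r : ℝ) / d by linarith)
      (by linarith [show 0 ≤ (r : ℝ) / d by positivity])
    linarith
  have hkge : l / -Real.log (1 - c * r / d) ≤ k := hk ▸ Nat.le_ceil _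
  have hkle : (k : ℝ) ≤ d * l / (c * r) + 1 := by
    have hceil := (Nat.ceil_lt_add_one
      (show 0 ≤ l / -Real.log (1 - c * r / d) by positivity)).le
    rw [← hk] at hceil
    have : l / -Real.log (1 - c * r / d) ≤ l / (c * r / d) := by gcongr
    have h : l / (c * r / d) = d * l / (c * r) := by field_simp
    linarith
  have hloss := exponent_loss_le_two hl hc hr' hd' (Nat.cast_nonneg k) hkle
    (t := 2 * Real.exp 2 * (lam + 1)) (by linarith) h2 h3' h4' hs2'
    (by linarith)
  have hρ : (n : ℝ) ^ (Real.log (1 - (r : ℝ) / d) / Real.log (1 - c * r / d))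
      = Real.exp (b * (l / -Real.log (1 - c * r / d))) := by
    rw [Real.rpow_def_of_pos (by linarith), hb]
    congr 1
    have : Real.log (1 - c * r / d) ≠ 0 := by linarith
    field_simp
    ring
  have hLle : (L : ℝ) ≤ (lam + 1) * Real.exp (b * k) := by
    set y := Real.exp (b * (l / -Real.log (1 - c * r / d))) with hy
    have hy1 : 1 ≤ y := Real.one_le_exp (by positivity)
    have hyk : y ≤ Real.exp (b * k) := Real.exp_le_exp.2 (by gcongr)
    have hceil := (Nat.ceil_lt_add_one (show 0 ≤ lam * y by positivity)).le
    rw [hρ] at hL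
    rw [← hL] at hceil
    nlinarith
  set x := 7 * l * max 1 ((k : ℝ) ^ 2 / (2 * d)) with hx
  have hε : ∀ j, (1 - (s : ℝ) / d) ^ (Finset.image (G j) Finset.univ).card
      ≤ Real.exp (-(a * (k - x))) := by
    intro j
    have h := mul_le_mul_of_nonneg_left (hG j) ha0
    have hexp : 1 - (s : ℝ) / d = Real.exp (-a) := by
      rw [ha, neg_neg, Real.exp_log (by linarith)]
    rw [hexp, ← Real.exp_nat_mul]
    refine Real.exp_le_exp.2 ?_
    linarith
  have hsd : s ≤ d := by
    have : (s : ℝ) ≤ d := by linarith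
    exact_mod_cast this
  calc _ ≤ (L : ℝ) * Real.exp (-(a * (k - x))) := expected_collisions_le hsd z G hε
    _ ≤ (lam + 1) * Real.exp (b * k) * Real.exp (-(a * (k - x))) := by gcongr
    _ = (lam + 1) * Real.exp (b * k - a * (k - x)) := by
      rw [mul_assoc, ← Real.exp_add, ← sub_eq_add_neg]
    _ ≤ (lam + 1) * Real.exp 2 := by gcongr
    _ = Real.exp 2 * (lam + 1) := mul_comm _ _
end

section
/- Let d, k, r, x, t be real numbers with d > 0, 0 ≤ x ≤ k, k − x ≤ d, 0 ≤ t ≤ r, and r/d ≤ 1/5. Then (1 − (k−x)/d)^(r−t) ≤ (1 − r/d)^k · exp( t·k/d + k·r²/d² + x·(r−t)/d ). -/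
/-- A quadratic exponential lower bound for `1 - u` near zero. -/
theorem exp_neg_add_sq_le_one_sub_s6 {u : ℝ} (hu0 : 0 ≤ u) (hu : u ≤ 1/5) :
    Real.exp (-(u + u^2)) ≤ 1 - u := by
  have hq := Real.quadratic_le_exp_of_nonneg (x := u + u^2) (by positivity)
  have hpoly : 1 ≤ (1 - u) * (1 + (u + u^2) + (u + u^2)^2 / 2) := by
    have h : 0 ≤ (1 - u) * (1 + u)^2 / 2 - u := by
      nlinarith [mul_nonneg hu0 hu0, mul_nonneg (mul_nonneg hu0 hu0) (sub_nonneg.2 hu)]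
    nlinarith [mul_nonneg (sq_nonneg u) h]
  rw [Real.exp_neg, inv_le_iff_one_le_mul₀ (Real.exp_pos _)]
  exact hpoly.trans (mul_le_mul_of_nonneg_left hq (by linarith))

/-- Core estimate in the proof of Lemma 4.3:
`(1 − (k−x)/d)^(r−t) ≤ (1 − r/d)^k · exp(t·k/d + k·r²/d² + x·(r−t)/d)`. -/
theorem ratio_bound (d k r x t : ℝ) (hd : 0 < d) (hx0 : 0 ≤ x) (hxk : x ≤ k)
    (hkd : k - x ≤ d) (ht0 : 0 ≤ t) (htr : t ≤ r) (hrd : r / d ≤ 1/5) :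
    (1 - (k - x) / d) ^ (r - t)
      ≤ (1 - r / d) ^ k * Real.exp (t * k / d + k * r^2 / d^2 + x * (r - t) / d) := by
  have hleft : (1 - (k - x) / d) ^ (r - t) ≤ Real.exp (-((k - x) / d) * (r - t)) := by
    rw [Real.exp_mul]
    exact Real.rpow_le_rpow (sub_nonneg.2 ((div_le_one hd).2 hkd))
      (Real.one_sub_le_exp_neg _) (sub_nonneg.2 htr)
  have hright : Real.exp (-(r / d + (r / d)^2) * k) ≤ (1 - r / d) ^ k := by
    rw [Real.exp_mul]
    exact Real.rpow_le_rpow (Real.exp_pos _).le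
      (exp_neg_add_sq_le_one_sub_s6 (div_nonneg (ht0.trans htr) hd.le) hrd) (hx0.trans hxk)
  refine hleft.trans (le_trans (le_of_eq ?_)
    (mul_le_mul_of_nonneg_right hright (Real.exp_pos _).le))
  rw [← Real.exp_add]
  congr 1
  field_simp
  ring
end

section
/- Let n, d, r be positive integers with n ≥ 3 and let c ≥ 1, λ > 0 be reals such that c·r is a positive integer, c·r/d ≤ 1/5, c ≥ 1 + (80 + 16·ln(λ+1))/ln n, and 8e²(λ+1) ≤ n^(1/8). Set p₂ = 1 − c·r/d and k = ⌈ln n/(−ln p₂)⌉. Let z be a point of the d-dimensional Hamming cube, let G be any finite family of hash functions (tuples in Fin k → Fin d) each of which has support size at least k/2, and let q be a point with dist(q, z) ≤ r such that |Coll(q, z)| ≤ 2e²(λ+1). Let q′ be drawn uniformly at random from the set of points at Hamming distance exactly c·r from z that satisfy: for every coordinate i, if q i ≠ z i then q′ i ≠ z i. Then with probability at least 1 − 1/(32e²(λ+1)), Coll(q′, z) is empty, i.e., no hash function in G hashes q′ and z together. -/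
theorem choose_sub_le_exp_mul_choose (N b s : ℕ) (hs : s ≤ N) (hN : 0 < N) :
    ((N - s).choose b : ℝ) ≤ Real.exp (-((b : ℝ) / N * s)) * (N.choose b : ℝ) := by
  induction s with
  | zero => simp
  | succ s ih =>
    have ih := ih (by omega)
    obtain ⟨M, hM⟩ : ∃ M, N - s = M + 1 := ⟨N - s - 1, by omega⟩
    have hM' : N - (s + 1) = M := by omega
    rw [hM] at ih
    rw [hM']
    have hN' : (0 : ℝ) < N := by exact_mod_cast hN
    have hstep : (M.choose b : ℝ) ≤ (1 - (b : ℝ) / N) * ((M + 1).choose b : ℝ) := by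
      rcases Nat.lt_or_ge (M + 1) b with h | h
      · simp [Nat.choose_eq_zero_of_lt h, Nat.choose_eq_zero_of_lt (show M < b by omega)]
      · have hmul : (M.choose b : ℝ) * (M + 1) = ((M + 1).choose b : ℝ) * (M + 1 - b) := by
          have h1 := Nat.choose_mul_succ_eq M b
          have h2 : ((M + 1 - b : ℕ) : ℝ) = (M : ℝ) + 1 - b := by
            rw [Nat.cast_sub h]; push_cast; ring
          rw [← h2]
          exact_mod_cast h1
        have hMpos : (0 : ℝ) < (M : ℝ) + 1 := by positivity
        have hfrac : (b : ℝ) / N ≤ b / ((M : ℝ) + 1) := by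
          have : (M : ℝ) + 1 ≤ N := by exact_mod_cast (show M + 1 ≤ N by omega)
          gcongr
        have heq : (M.choose b : ℝ) = (1 - (b : ℝ) / (M + 1)) * ((M + 1).choose b : ℝ) := by
          field_simp
          linarith
        rw [heq]
        gcongr
    have hexp : 1 - (b : ℝ) / N ≤ Real.exp (-((b : ℝ) / N)) := by
      have := Real.add_one_le_exp (-((b : ℝ) / N))
      linarith
    calc (M.choose b : ℝ) ≤ (1 - (b : ℝ) / N) * ((M + 1).choose b : ℝ) := hstep
      _ ≤ Real.exp (-((b : ℝ) / N)) *
          (Real.exp (-((b : ℝ) / N * s)) * (N.choose b : ℝ)) := by gcongr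
      _ = Real.exp (-((b : ℝ) / N * (s + 1 : ℕ))) * (N.choose b : ℝ) := by
          rw [← mul_assoc, ← Real.exp_add]
          congr 2
          push_cast
          ring

/-- The number of points at distance `m` from `z` that differ from `z` wherever `q` does and agree
with `z` on `T`, where `q` and `z` agree on `T`. -/
theorem card_filter_hammingDist_eq_choose {ι : Type*} [Fintype ι] [DecidableEq ι]
    (z q : ι → Bool) (m : ℕ) (hm : hammingDist q z ≤ m) (T : Finset ι)
    (hT : ∀ i ∈ T, q i = z i) :
    (Finset.univ.filter (fun p : ι → Bool =>
      (hammingDist p z = m ∧ ∀ i, q i ≠ z i → p i ≠ z i) ∧ ∀ i ∈ T, p i = z i)).card =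
    (Fintype.card ι - hammingDist q z - T.card).choose (m - hammingDist q z) := by
  set D : Finset ι := Finset.univ.filter (fun i => q i ≠ z i) with hD
  have hDc : hammingDist q z = D.card := rfl
  rw [hDc] at hm ⊢
  have hdisj : Disjoint D T := by
    rw [Finset.disjoint_left]
    intro i hi hiT
    simp only [hD, Finset.mem_filter] at hi
    exact hi.2 (hT i hiT)
  have hcard : (Finset.univ \ (D ∪ T)).card = Fintype.card ι - D.card - T.card := by
    rw [Finset.card_sdiff_of_subset (Finset.subset_univ _), Finset.card_union_of_disjoint hdisj,
      Finset.card_univ]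
    omega
  rw [← hcard, ← Finset.card_powersetCard]
  refine Finset.card_bij' (fun p _ => Finset.univ.filter (fun i => p i ≠ z i) \ D)
    (fun U _ i => if i ∈ U ∪ D then !z i else z i) ?_ ?_ ?_ ?_
  · intro p hp
    simp only [Finset.mem_filter, Finset.mem_univ, true_and] at hp
    obtain ⟨⟨h1, h2⟩, h3⟩ := hp
    rw [Finset.mem_powersetCard]
    constructor
    · intro i hi
      simp only [Finset.mem_sdiff, Finset.mem_filter, Finset.mem_univ, true_and,
        Finset.mem_union] at hi ⊢
      rintro (h | h)
      · exact hi.2 h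
      · exact hi.1 (h3 i h)
    · rw [Finset.card_sdiff_of_subset]
      · rw [← h1]; rfl
      · intro i hi
        simp only [hD, Finset.mem_filter, Finset.mem_univ, true_and] at hi ⊢
        exact h2 i hi
  · intro U hU
    rw [Finset.mem_powersetCard] at hU
    obtain ⟨hU1, hU2⟩ := hU
    have hne : ∀ i, (if i ∈ U ∪ D then !z i else z i) ≠ z i ↔ i ∈ U ∪ D := by
      intro i
      split_ifs with h <;> simp [h]
    have hUD : Disjoint U D := by
      rw [Finset.disjoint_left]
      intro i hi hiD
      have := hU1 hi
      simp [hiD] at this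
    simp only [Finset.mem_filter, Finset.mem_univ, true_and]
    refine ⟨⟨?_, ?_⟩, ?_⟩
    · unfold hammingDist
      simp only [hne]
      rw [Finset.filter_mem_eq_inter, Finset.univ_inter, Finset.card_union_of_disjoint hUD, hU2]
      omega
    · intro i hi
      rw [hne]
      exact Finset.mem_union_right _ (by simpa [hD] using hi)
    · intro i hi
      rw [if_neg]
      intro h
      rcases Finset.mem_union.1 h with h | h
      · have := hU1 h
        simp [hi] at this
      · exact Finset.disjoint_left.1 hdisj h hi
  · intro p hp
    simp only [Finset.mem_filter, Finset.mem_univ, true_and] at hp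
    obtain ⟨⟨h1, h2⟩, h3⟩ := hp
    funext i
    have h2' := h2 i
    by_cases hi : p i = z i
    · have : ¬ q i ≠ z i := fun h => h2' h hi
      simp [hD, hi, not_not.1 this]
    · have : p i = !z i := by
        revert hi; cases p i <;> cases z i <;> simp
      simp [hD, this]
  · intro U hU
    rw [Finset.mem_powersetCard] at hU
    ext i
    have hi : i ∈ U → i ∉ D := by
      intro h hiD
      have := hU.1 h
      simp [hiD] at this
    simp only [Finset.mem_sdiff, Finset.mem_filter, Finset.mem_univ, true_and, Finset.mem_union]
    by_cases h1 : i ∈ U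
    · simp [h1, hi h1]
    · by_cases h2 : i ∈ D <;> simp [h1, h2]

theorem two_mul_le_log_mul_div_log_one_sub {w c A x : ℝ} (hA : 0 ≤ A) (hw : 8 * A ≤ w)
    (hc1 : 1 < c) (hcw : 16 * A ≤ (c - 1) * w) (hx : 0 < x) (hx5 : x ≤ 1 / 5) :
    2 * A ≤ w / (-Real.log (1 - x)) / 2 * (x * (c - 1) / c) := by
  have hw0 : 0 ≤ w := by linarith
  have hlog : -Real.log (1 - x) ≤ 5 / 4 * x := by
    have h1 : 0 < 1 - x := by linarith
    have h2 := Real.one_sub_inv_le_log_of_pos h1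
    have h3 : (1 - x)⁻¹ ≤ 1 + 5 / 4 * x := by
      rw [inv_le_iff_one_le_mul₀ h1]
      nlinarith
    linarith
  have hlog0 : 0 < -Real.log (1 - x) := by
    have := Real.log_neg (show 0 < 1 - x by linarith) (by linarith)
    linarith
  have hc0 : 0 < c - 1 := by linarith
  calc 2 * A ≤ w * (c - 1) / c * (2 / 5) := by
        rw [div_mul_eq_mul_div, le_div_iff₀ (by linarith)]
        nlinarith [mul_le_mul_of_nonneg_right hw hc0.le]
    _ = w / (5 / 4 * x) / 2 * (x * (c - 1) / c) := by
        field_simp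
        norm_num
    _ ≤ _ := by gcongr


/-- Lemma 4.4 of the paper: under the stated parameter assumptions, if every hash function
in the finite family `G` has support size at least `k/2`, `dist(q, z) ≤ r` and
`|Coll(q, z)| ≤ 2e²(λ+1)`, and `q′` is drawn uniformly at random from the points at
Hamming distance exactly `c·r` from `z` that disagree with `z` wherever `q` does, then
with probability at least `1 − 1/(32e²(λ+1))` no hash function of `G` hashes `q′` and `z`
together. -/
theorem far_point_no_collision (n d r : ℕ) (hn : 3 ≤ n) (hd : 0 < d) (hr : 0 < r)
    (c lam : ℝ) (hlam : 0 < lam)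
    (cr : ℕ) (hcr0 : 0 < cr) (hcrval : (cr : ℝ) = c * r)
    (hcrd : c * r / d ≤ 1/5)
    (hc : 1 + (80 + 16 * Real.log (lam + 1)) / Real.log n ≤ c)
    (h8 : 8 * Real.exp 2 * (lam + 1) ≤ (n : ℝ) ^ ((1 : ℝ) / 8))
    (k : ℕ) (hk : k = ⌈Real.log n / (-Real.log (1 - c * r / d))⌉₊)
    (z : Fin d → Bool)
    (G : Finset (Fin k → Fin d))
    (hG : ∀ g ∈ G, (k : ℝ) / 2 ≤ ((Finset.image g Finset.univ).card : ℝ))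
    (q : Fin d → Bool) (hq : hammingDist q z ≤ r)
    (hColl : ((G.filter (fun g => ∀ m : Fin k, q (g m) = z (g m))).card : ℝ)
        ≤ 2 * Real.exp 2 * (lam + 1)) :
    1 - 1 / (32 * Real.exp 2 * (lam + 1)) ≤
      ((Finset.univ.filter (fun q' : Fin d → Bool =>
            (hammingDist q' z = cr ∧ ∀ i, q i ≠ z i → q' i ≠ z i) ∧
            ∀ g ∈ G, ∃ m : Fin k, q' (g m) ≠ z (g m))).card : ℝ)
        / ((Finset.univ.filter (fun q' : Fin d → Bool =>
            hammingDist q' z = cr ∧ ∀ i, q i ≠ z i → q' i ≠ z i)).card : ℝ) := by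
  have hn0 : (0 : ℝ) < n := by positivity
  have hw0 : 0 < Real.log n := Real.log_pos (by exact_mod_cast (show 1 < n by omega))
  have hL : 0 ≤ Real.log (lam + 1) := Real.log_nonneg (by linarith)
  have hd' : (0 : ℝ) < d := by exact_mod_cast hd
  have hr' : (0 : ℝ) < r := by exact_mod_cast hr
  obtain ⟨A, hA⟩ : ∃ A, A = Real.log (8 * Real.exp 2 * (lam + 1)) := ⟨_, rfl⟩
  have hAeq : A = Real.log 8 + 2 + Real.log (lam + 1) := by
    rw [hA, Real.log_mul (by positivity) (by positivity), Real.log_mul (by positivity)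
      (by positivity), Real.log_exp]
  have hlog8 : Real.log 8 ≤ 3 := by
    have h2 : Real.log 8 = 3 * Real.log 2 := by
      rw [show (8 : ℝ) = 2 ^ 3 by norm_num, Real.log_pow]
      norm_num
    linarith [Real.log_two_lt_d9]
  have hlog80 : 0 ≤ Real.log 8 := Real.log_nonneg (by norm_num)
  have hA0 : 0 ≤ A := by linarith
  have hexpA : Real.exp A = 8 * Real.exp 2 * (lam + 1) := by
    rw [hA, Real.exp_log (by positivity)]
  have hw : 8 * A ≤ Real.log n := by
    have := Real.log_le_log (by positivity) h8
    rw [← hA, Real.log_rpow hn0] at this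
    linarith
  have hcw0 : 80 + 16 * Real.log (lam + 1) ≤ (c - 1) * Real.log n := by
    rw [← div_le_iff₀ hw0]
    linarith
  have hc1 : 1 < c := by
    by_contra! h
    nlinarith
  have hcw : 16 * A ≤ (c - 1) * Real.log n := by linarith
  have hx : 0 < c * r / d := by positivity
  have hnum := two_mul_le_log_mul_div_log_one_sub hA0 hw hc1 hcw hx hcrd
  have hkge : Real.log n / (-Real.log (1 - c * r / d)) ≤ k := by
    rw [hk]
    exact Nat.le_ceil _
  have hrcr : r < cr := by
    have : (r : ℝ) < cr := by
      rw [hcrval]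
      nlinarith
    exact_mod_cast this
  have hcrd' : cr ≤ d := by
    have : (cr : ℝ) ≤ d := by
      rw [hcrval]
      rw [div_le_iff₀ hd'] at hcrd
      linarith
    exact_mod_cast this
  set a := hammingDist q z with ha
  have ham : a ≤ cr := by omega
  have htot : (Finset.univ.filter (fun p : Fin d → Bool =>
      hammingDist p z = cr ∧ ∀ i, q i ≠ z i → p i ≠ z i)).card = (d - a).choose (cr - a) := by
    have := card_filter_hammingDist_eq_choose z q cr ham ∅ (by simp)
    simpa using this
  set Ω := Finset.univ.filter (fun p : Fin d → Bool =>
      hammingDist p z = cr ∧ ∀ i, q i ≠ z i → p i ≠ z i) with hΩ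
  have hΩpos : (0 : ℝ) < Ω.card := by
    rw [htot]
    exact_mod_cast Nat.choose_pos (by omega)
  have hbad : ∀ g ∈ G.filter (fun g => ∀ m : Fin k, q (g m) = z (g m)),
      ((Ω.filter (fun p => ∀ m : Fin k, p (g m) = z (g m))).card : ℝ) ≤
        Real.exp (-(2 * A)) * Ω.card := by
    intro g hg
    obtain ⟨hgG, hgq⟩ := Finset.mem_filter.1 hg
    have hT : ∀ i ∈ Finset.image g Finset.univ, q i = z i := by simpa using hgq
    have hc := card_filter_hammingDist_eq_choose z q cr ham (Finset.image g Finset.univ) hT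
    have hs := hG g hgG
    set T := Finset.image g Finset.univ with hTdef
    have hTd : T.card ≤ d - a := by
      have hsub : T ⊆ Finset.univ \ Finset.univ.filter (fun i => q i ≠ z i) := by
        intro i hi
        simp [hT i hi]
      have := Finset.card_le_card hsub
      rwa [Finset.card_sdiff_of_subset (Finset.subset_univ _), Finset.card_fin] at this
    have hcard : (Ω.filter (fun p => ∀ m : Fin k, p (g m) = z (g m))).card =
        (Fintype.card (Fin d) - a - T.card).choose (cr - a) := by
      refine (congrArg Finset.card (Finset.ext fun p => ?_)).trans hc
      simp [hΩ, hTdef]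
    rw [hcard, htot, Fintype.card_fin]
    refine (choose_sub_le_exp_mul_choose (d - a) (cr - a) T.card hTd (by omega)).trans ?_
    refine mul_le_mul_of_nonneg_right (Real.exp_le_exp.2 (neg_le_neg (hnum.trans ?_)))
      (Nat.cast_nonneg _)
    rw [mul_comm]
    have hcast1 : ((cr - a : ℕ) : ℝ) = cr - a := Nat.cast_sub ham
    have hda : (0 : ℝ) < ((d - a : ℕ) : ℝ) := by exact_mod_cast (show 0 < d - a by omega)
    have hda' : ((d - a : ℕ) : ℝ) ≤ d := by exact_mod_cast Nat.sub_le d a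
    have har : (a : ℝ) ≤ r := by exact_mod_cast hq
    have hratio : c * r / d * (c - 1) / c ≤ ((cr - a : ℕ) : ℝ) / ((d - a : ℕ) : ℝ) := by
      have h1 : c * r / d * (c - 1) / c = (c * r - r) / d := by
        field_simp
      rw [h1, hcast1, hcrval]
      have h2 : (0 : ℝ) ≤ c * r - r := by nlinarith
      have h3 : c * r - r ≤ c * r - (a : ℝ) := by linarith
      exact div_le_div₀ (h2.trans h3) h3 hda hda'
    have hlogx : 0 < -Real.log (1 - c * r / d) := by
      have := Real.log_neg (show 0 < 1 - c * r / d by linarith) (by linarith)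
      linarith
    refine mul_le_mul hratio (by linarith) (by positivity) (by positivity)
  set E := Finset.univ.filter (fun p : Fin d → Bool =>
      (hammingDist p z = cr ∧ ∀ i, q i ≠ z i → p i ≠ z i) ∧
        ∀ g ∈ G, ∃ m : Fin k, p (g m) ≠ z (g m)) with hE
  have hcover : Ω ⊆ E ∪ (G.filter (fun g => ∀ m : Fin k, q (g m) = z (g m))).biUnion
      (fun g => Ω.filter (fun p => ∀ m : Fin k, p (g m) = z (g m))) := by
    intro p hp
    have hp' := (Finset.mem_filter.1 hp).2
    by_cases h : ∀ g ∈ G, ∃ m : Fin k, p (g m) ≠ z (g m)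
    · exact Finset.mem_union_left _ (Finset.mem_filter.2 ⟨Finset.mem_univ _, hp', h⟩)
    · push Not at h
      obtain ⟨g, hg, hgp⟩ := h
      refine Finset.mem_union_right _ (Finset.mem_biUnion.2 ⟨g, Finset.mem_filter.2 ⟨hg, ?_⟩,
        Finset.mem_filter.2 ⟨hp, hgp⟩⟩)
      intro m
      by_contra hne
      exact hp'.2 _ hne (hgp m)
  have hcount : (Ω.card : ℝ) ≤ E.card +
      2 * Real.exp 2 * (lam + 1) * (Real.exp (-(2 * A)) * Ω.card) := by
    have h1 := (Finset.card_le_card hcover).trans ((Finset.card_union_le _ _).trans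
      (Nat.add_le_add_left Finset.card_biUnion_le _))
    have h2 : (Ω.card : ℝ) ≤ E.card +
        ∑ g ∈ G.filter (fun g => ∀ m : Fin k, q (g m) = z (g m)),
          ((Ω.filter (fun p => ∀ m : Fin k, p (g m) = z (g m))).card : ℝ) := by
      exact_mod_cast h1
    have h3 := Finset.sum_le_card_nsmul _ _ _ hbad
    rw [nsmul_eq_mul] at h3
    have h4 := mul_le_mul_of_nonneg_right hColl
      (show 0 ≤ Real.exp (-(2 * A)) * (Ω.card : ℝ) by positivity)
    linarith
  have hδ : 2 * Real.exp 2 * (lam + 1) * Real.exp (-(2 * A)) =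
      1 / (32 * Real.exp 2 * (lam + 1)) := by
    rw [Real.exp_neg, two_mul A, Real.exp_add, hexpA]
    field_simp
    norm_num
  rw [le_div_iff₀ hΩpos, ← hδ]
  linarith
end

section
/- Let n, d, r be positive integers with n ≥ 3, and let c, λ be reals such that c·r is a positive integer and: 28·(ln n)³ ≤ r ≤ d/(28·ln n), 0 < λ ≤ (1/(8e²))·min{r/ln n, n^(1/8)} − 1, and 1 + (80 + 16·ln(λ+1))/ln n ≤ c ≤ ln n. Set p₂ = 1 − c·r/d, k = ⌈ln n/(−ln p₂)⌉, ρ = ln(1 − r/d)/ln(1 − c·r/d), and L = ⌈λ·n^ρ⌉. Let z be a point of the d-dimensional Hamming cube and let G : Fin L → (Fin k → Fin d) be any family of hash functions each of which has support size at least k − 7·(ln n)·max{1, k²/(2d)}. Then there exists a point q of the Hamming cube with dist(q, z) ≤ r such that Coll(q, z) is empty, i.e., for every j ∈ Fin L there is some m ∈ Fin k with q (G j m) ≠ z (G j m). -/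
/-- Some point lies in at least the average fraction `s / d` of a finite family of sets. -/
lemma exists_mem_card_ge_average {α ι : Type*} [Fintype α] [Nonempty α] [DecidableEq α]
    (T : ι → Finset α) (U : Finset ι) (s : ℝ) (hs : ∀ j ∈ U, s ≤ ((T j).card : ℝ)) :
    ∃ a : α, s * U.card ≤ Fintype.card α * ((U.filter fun j => a ∈ T j).card : ℝ) := by
  have hcount : ∑ a : α, ((U.filter fun j => a ∈ T j).card : ℝ)
      = ∑ j ∈ U, ((T j).card : ℝ) := by
    simp only [Finset.card_filter, Nat.cast_sum]
    rw [Finset.sum_comm]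
    refine Finset.sum_congr rfl fun j _ => ?_
    simp
  have hsum : ∑ _a : α, s * (U.card : ℝ)
      ≤ ∑ a : α, Fintype.card α * ((U.filter fun j => a ∈ T j).card : ℝ) := by
    rw [Finset.sum_const, Finset.card_univ, nsmul_eq_mul, ← Finset.mul_sum, hcount]
    refine mul_le_mul_of_nonneg_left ?_ (Nat.cast_nonneg _)
    calc s * (U.card : ℝ) = ∑ _j ∈ U, s := by rw [Finset.sum_const, nsmul_eq_mul, mul_comm]
      _ ≤ _ := Finset.sum_le_sum hs
  obtain ⟨a, -, ha⟩ := Finset.exists_le_of_sum_le Finset.univ_nonempty hsum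
  exact ⟨a, ha⟩

/-- Greedy covering: `m` points can be chosen so that at most `|U| * exp (-(s / d) * m)` of the
sets of a family `U` avoid all of them. -/
lemma exists_greedy_hitting {α ι : Type*} [Fintype α] [Nonempty α] [DecidableEq α]
    (T : ι → Finset α) (U : Finset ι) (s : ℝ) (hs : ∀ j ∈ U, s ≤ ((T j).card : ℝ)) (m : ℕ) :
    ∃ S : Finset α, S.card ≤ m ∧
      ((U.filter fun j => Disjoint (T j) S).card : ℝ)
        ≤ U.card * Real.exp (-(s / Fintype.card α) * m) := by
  induction m with
  | zero => exact ⟨∅, by simp⟩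
  | succ m ih =>
    obtain ⟨S, hSm, hS⟩ := ih
    set V := U.filter fun j => Disjoint (T j) S with hV
    obtain ⟨a, ha⟩ := exists_mem_card_ge_average T V s
      fun j hj => hs j (Finset.mem_filter.mp hj).1
    refine ⟨insert a S, (Finset.card_insert_le _ _).trans (by omega), ?_⟩
    have hd : (0 : ℝ) < Fintype.card α := by exact_mod_cast Fintype.card_pos
    have hrest : (U.filter fun j => Disjoint (T j) (insert a S))
        = V.filter fun j => ¬ a ∈ T j := by
      ext j
      simp only [hV, Finset.mem_filter, Finset.disjoint_insert_right]
      tauto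
    have hsplit : ((V.filter fun j => a ∈ T j).card : ℝ)
        + ((V.filter fun j => ¬ a ∈ T j).card : ℝ) = V.card := by
      exact_mod_cast Finset.card_filter_add_card_filter_not (s := V) (fun j => a ∈ T j)
    have hfrac : s / Fintype.card α * V.card ≤ ((V.filter fun j => a ∈ T j).card : ℝ) := by
      rw [div_mul_eq_mul_div, div_le_iff₀ hd]
      linarith
    have hexp := Real.add_one_le_exp (-(s / Fintype.card α))
    rw [hrest]
    calc ((V.filter fun j => ¬ a ∈ T j).card : ℝ)
        ≤ V.card * (-(s / Fintype.card α) + 1) := by linarith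
      _ ≤ V.card * Real.exp (-(s / Fintype.card α)) := by gcongr
      _ ≤ U.card * Real.exp (-(s / Fintype.card α) * m) * Real.exp (-(s / Fintype.card α)) := by
          gcongr
      _ = U.card * Real.exp (-(s / Fintype.card α) * (m + 1 : ℕ)) := by
          rw [mul_assoc, ← Real.exp_add]
          push_cast
          ring_nf

/-- Sets of size at least `s > 0` have a hitting set of size `m + t` as soon as the greedy choice
of `m` points leaves at most `t` of them. -/
lemma exists_hitting_set {α ι : Type*} [Fintype α] [Nonempty α] [DecidableEq α] [Fintype ι]
    (T : ι → Finset α) (s : ℝ) (hs0 : 0 < s) (hs : ∀ j, s ≤ ((T j).card : ℝ)) (m t : ℕ)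
    (h : Fintype.card ι * Real.exp (-(s / Fintype.card α) * m) ≤ t) :
    ∃ S : Finset α, S.card ≤ m + t ∧ ∀ j, ∃ a ∈ T j, a ∈ S := by
  obtain ⟨S, hSm, hS⟩ := exists_greedy_hitting T Finset.univ s (fun j _ => hs j) m
  have hne : ∀ j, ∃ a, a ∈ T j := fun j => by
    have : (0 : ℝ) < (T j).card := hs0.trans_le (hs j)
    exact Finset.card_pos.mp (by exact_mod_cast this)
  choose f hf using hne
  set V := Finset.univ.filter fun j => Disjoint (T j) S with hV
  have hVt : V.card ≤ t := by
    rw [Finset.card_univ] at hS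
    exact_mod_cast hS.trans h
  refine ⟨S ∪ V.image f, ?_, fun j => ?_⟩
  · have := Finset.card_union_le S (V.image f)
    have := Finset.card_image_le (s := V) (f := f)
    omega
  · by_cases hj : Disjoint (T j) S
    · exact ⟨f j, hf j, Finset.mem_union_right _
        (Finset.mem_image_of_mem f (Finset.mem_filter.mpr ⟨Finset.mem_univ j, hj⟩))⟩
    · obtain ⟨a, haT, haS⟩ := Finset.not_disjoint_iff.mp hj
      exact ⟨a, haT, Finset.mem_union_left _ haS⟩

/-- Flipping a set of coordinates that meets the image of every hash function produces a point
with no collisions. -/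
lemma exists_no_collision_of_hitting {d k L r : ℕ} (z : Fin d → Bool)
    (G : Fin L → Fin k → Fin d) (S : Finset (Fin d)) (hS : S.card ≤ r)
    (hit : ∀ j, ∃ a ∈ Finset.image (G j) Finset.univ, a ∈ S) :
    ∃ q : Fin d → Bool, hammingDist q z ≤ r ∧
      ∀ j : Fin L, ∃ m : Fin k, q (G j m) ≠ z (G j m) := by
  refine ⟨fun i => if i ∈ S then !z i else z i, ?_, fun j => ?_⟩
  · refine le_trans (Finset.card_le_card fun i hi => ?_) hS
    by_contra hiS
    simp [hiS] at hi
  · obtain ⟨a, ha, haS⟩ := hit j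
    obtain ⟨m, -, rfl⟩ := Finset.mem_image.mp ha
    exact ⟨m, by simp [haS]⟩

/-- `-log (1 - x) ≤ x + x ^ 2` for small nonnegative `x`. -/
lemma neg_log_one_sub_le {x : ℝ} (hx0 : 0 ≤ x) (hx : x ≤ 1 / 2) :
    -Real.log (1 - x) ≤ x + x ^ 2 := by
  have hpos : 0 < 1 - x := by linarith
  have h1 : (1 - x)⁻¹ ≤ Real.exp (x + x ^ 2) := by
    refine le_trans ?_ (Real.quadratic_le_exp_of_nonneg (by positivity))
    rw [inv_le_iff_one_le_mul₀ hpos]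
    have h : 0 ≤ x ^ 2 * (1 - x - x ^ 2 - x ^ 3) := by
      have h2 : x ^ 2 ≤ (1 / 2) ^ 2 := by gcongr
      have h3 : x ^ 3 ≤ (1 / 2) ^ 3 := by gcongr
      exact mul_nonneg (sq_nonneg x) (by linarith)
    linear_combination h / 2
  rw [← Real.log_inv]
  exact (Real.log_le_iff_le_exp (inv_pos.mpr hpos)).mpr h1

lemma le_neg_log_one_sub {x : ℝ} (hx : x < 1) : x ≤ -Real.log (1 - x) := by
  have := Real.log_le_sub_one_of_pos (show 0 < 1 - x by linarith)
  linarith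

/-- With `A = log n`, `y = r / d`, `K` the real-valued length `k`, the
exponent left after greedily choosing `r - t` points is bounded by `3 / 2`. -/
lemma exponent_le {A r d c K t l₁ l₂ s : ℝ} (hA : 1 ≤ A) (hr : 0 < r) (hd : 0 < d)
    (h1 : 28 * A ^ 3 ≤ r) (h2 : 28 * A * r ≤ d) (hc1 : 1 ≤ c)
    (hl1 : l₁ ≤ r / d + (r / d) ^ 2) (hl2 : c * r / d ≤ l₂)
    (hK1 : A / l₂ ≤ K) (hK2 : K ≤ A / l₂ + 1)
    (ht0 : 0 ≤ t) (ht : t ≤ r / A)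
    (hs : s = K - 7 * A * max 1 (K ^ 2 / (2 * d))) :
    A * (l₁ / l₂) + -(s / d) * (r - t) ≤ 3 / 2 := by
  have hA0 : 0 < A := by linarith
  have hc0 : 0 < c := by linarith
  set y := r / d with hy
  have hy0 : 0 < y := by positivity
  have hyA : y * A ≤ 1 / 28 := by
    rw [hy, div_mul_eq_mul_div, div_le_iff₀ hd]; linarith
  have hy1 : y ≤ 1 / 28 := by nlinarith
  have hcy : c * y ≤ l₂ := by rw [hy, ← mul_div_assoc]; exact hl2
  have hyl : y ≤ l₂ := by nlinarith
  have hl20 : 0 < l₂ := by linarith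
  have hQ : A / l₂ * y ≤ A := by
    rw [div_mul_eq_mul_div, div_le_iff₀ hl20]; nlinarith
  have hQ0 : 0 < A / l₂ := by positivity
  have hK0 : 0 < K := by linarith
  have hKy : K * y ≤ A + 1 / 28 := by nlinarith
  have hmain : A * (l₁ / l₂) ≤ K * y + 1 / 28 := by
    have : A * (l₁ / l₂) = A / l₂ * l₁ := by ring
    rw [this]
    have : A / l₂ * l₁ ≤ A / l₂ * (y + y ^ 2) := by gcongr
    nlinarith
  have hloss : 7 * A * max 1 (K ^ 2 / (2 * d)) * y ≤ 1 / 4 := by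
    rcases max_cases 1 (K ^ 2 / (2 * d)) with ⟨h, -⟩ | ⟨h, -⟩ <;> rw [h]
    · linarith
    · have e : 7 * A * (K ^ 2 / (2 * d)) * y = 7 * A * (K * y) ^ 2 / (2 * r) := by
        rw [hy]; field_simp
      rw [e, div_le_iff₀ (by positivity)]
      have : (K * y) ^ 2 ≤ (A + 1 / 28) ^ 2 := by gcongr
      nlinarith [mul_le_mul_of_nonneg_left this hA0.le, mul_nonneg hA0.le (sub_nonneg.mpr hA),
        mul_nonneg (mul_nonneg hA0.le hA0.le) (sub_nonneg.mpr hA)]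
  have hty : t / d ≤ y / A := by
    rw [hy, div_div, mul_comm, ← div_div]
    gcongr
  have hgreedy : K * (t / d) ≤ 1 + 1 / 28 := by
    have : K * (t / d) ≤ K * y / A := by
      rw [mul_div_assoc]; gcongr
    refine this.trans ?_
    rw [div_le_iff₀ hA0]; linarith
  have hsK : s * (t / d) ≤ K * (t / d) := by
    have hm : 0 ≤ 7 * A * max 1 (K ^ 2 / (2 * d)) := by positivity
    have : 0 ≤ t / d := by positivity
    gcongr
    linarith
  have e : -(s / d) * (r - t) = -(K * y) + 7 * A * max 1 (K ^ 2 / (2 * d)) * y + s * (t / d) := by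
    have : -(s / d) * (r - t) = - s * y + s * (t / d) := by rw [hy]; ring
    rw [this, hs]; ring
  rw [e]
  linarith

/-- The lower bound on the support sizes is positive. -/
lemma support_bound_pos {A r d c K l₂ : ℝ} (hA : 1 ≤ A) (hr : 1 ≤ r) (hd : 0 < d)
    (h1 : 28 * A ^ 3 ≤ r) (h2 : 28 * A * r ≤ d) (hc1 : 1 ≤ c) (hc2 : c ≤ A)
    (hl2 : c * r / d ≤ l₂) (hl2' : l₂ ≤ c * r / d + (c * r / d) ^ 2)
    (hK1 : A / l₂ ≤ K) (hK2 : K ≤ A / l₂ + 1) :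
    0 < K - 7 * A * max 1 (K ^ 2 / (2 * d)) := by
  have hA0 : 0 < A := by linarith
  have hr0 : 0 < r := by linarith
  have hc0 : 0 < c := by linarith
  have hx0 : 0 < c * r / d := by positivity
  have hl20 : 0 < l₂ := by linarith
  have hx : c * r / d ≤ 1 / 28 := by
    rw [div_le_iff₀ hd]; nlinarith
  have hKlow : 14 * A ≤ A / l₂ := by
    have : l₂ ≤ 1 / 14 := by nlinarith
    rw [le_div_iff₀ hl20]; nlinarith
  have hK0 : 0 < K := by nlinarith
  have hAd : 28 * A ≤ d := by nlinarith
  have hup : A / l₂ * A ≤ d / 28 := by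
    have hyl : r / d ≤ l₂ := by
      refine le_trans ?_ hl2
      gcongr
      nlinarith
    have : A / l₂ ≤ A / (r / d) := by gcongr
    have e : A / (r / d) * A = A ^ 2 / r * d := by field_simp
    have : A ^ 2 / r ≤ 1 / 28 := by
      rw [div_le_iff₀ hr0]; nlinarith [sq_nonneg A]
    nlinarith
  rw [sub_pos]
  rcases max_cases 1 (K ^ 2 / (2 * d)) with ⟨h, -⟩ | ⟨h, -⟩ <;> rw [h]
  · linarith
  · have e : 7 * A * (K ^ 2 / (2 * d)) = 7 * (K * A) / (2 * d) * K := by field_simp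
    have : 7 * (K * A) / (2 * d) < 1 := by
      rw [div_lt_one (by positivity)]
      nlinarith
    rw [e]
    nlinarith

/-- Deterministic existence content of Theorem 4.8 of the paper: under the stated parameter
assumptions, for any family `G` of hash functions each with support size at least
`k − 7·ln n·max{1, k²/(2d)}`, there exists a point `q` at Hamming distance at most `r` from
`z` colliding with `z` under no hash function of `G`. -/
theorem exists_false_negative (n d r : ℕ) (hn : 3 ≤ n) (hd : 0 < d) (hr : 0 < r)
    (c lam : ℝ)
    (cr : ℕ) (hcr0 : 0 < cr) (hcrval : (cr : ℝ) = c * r)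
    (h1 : 28 * (Real.log n)^3 ≤ (r : ℝ))
    (h2 : (r : ℝ) ≤ d / (28 * Real.log n))
    (hlam0 : 0 < lam)
    (hlam : lam ≤ (1 / (8 * Real.exp 2)) *
        min ((r : ℝ) / Real.log n) ((n : ℝ) ^ ((1 : ℝ) / 8)) - 1)
    (hc1 : 1 + (80 + 16 * Real.log (lam + 1)) / Real.log n ≤ c)
    (hc2 : c ≤ Real.log n)
    (k L : ℕ)
    (hk : k = ⌈Real.log n / (-Real.log (1 - c * r / d))⌉₊)
    (hL : L = ⌈lam * (n : ℝ) ^ (Real.log (1 - (r : ℝ) / d) / Real.log (1 - c * r / d))⌉₊)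
    (z : Fin d → Bool)
    (G : Fin L → Fin k → Fin d)
    (hG : ∀ j : Fin L,
        (k : ℝ) - 7 * Real.log n * max 1 ((k : ℝ)^2 / (2 * d))
          ≤ ((Finset.image (G j) Finset.univ).card : ℝ)) :
    ∃ q : Fin d → Bool, hammingDist q z ≤ r ∧
      ∀ j : Fin L, ∃ m : Fin k, q (G j m) ≠ z (G j m) := by

  have hn0 : (0 : ℝ) < n := by positivity
  have hd' : (0 : ℝ) < d := by exact_mod_cast hd
  have hr' : (1 : ℝ) ≤ r := by exact_mod_cast hr
  have hr0 : (0 : ℝ) < r := by linarith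
  set A := Real.log n with hA
  have hA0 : 0 < A := Real.log_pos (by exact_mod_cast (show 1 < n by omega))
  have hc : 1 ≤ c := by
    have : 0 ≤ (80 + 16 * Real.log (lam + 1)) / A := by
      have := Real.log_nonneg (show (1 : ℝ) ≤ lam + 1 by linarith)
      positivity
    linarith
  have hA1 : 1 ≤ A := hc.trans hc2
  have h2' : 28 * A * (r : ℝ) ≤ d := by
    rw [le_div_iff₀ (by positivity)] at h2
    linarith
  have hx : c * r / d ≤ 1 / 28 := by
    rw [div_le_iff₀ hd']; nlinarith
  have hx0 : 0 < c * r / d := by positivity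
  have hy : (r : ℝ) / d ≤ 1 / 28 := by
    rw [div_le_iff₀ hd']; nlinarith
  have hy0 : (0 : ℝ) < r / d := by positivity
  have hl1 := neg_log_one_sub_le hy0.le (by linarith)
  have hl2 := le_neg_log_one_sub (show c * r / d < 1 by linarith)
  have hl2' := neg_log_one_sub_le hx0.le (by linarith)
  rw [← neg_div_neg_eq (Real.log (1 - (r : ℝ) / d))] at hL
  set l₁ := -Real.log (1 - (r : ℝ) / d)
  set l₂ := -Real.log (1 - c * r / d)
  have hl10 : 0 ≤ l₁ := hy0.le.trans (le_neg_log_one_sub (by linarith))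
  have hl20 : 0 < l₂ := by linarith
  have hK1 : A / l₂ ≤ (k : ℝ) := hk ▸ Nat.le_ceil _
  have hK2 : (k : ℝ) ≤ A / l₂ + 1 := by
    rw [hk]; exact (Nat.ceil_lt_add_one (by positivity)).le
  have hpow : (n : ℝ) ^ (l₁ / l₂) = Real.exp (A * (l₁ / l₂)) := Real.rpow_def_of_pos hn0 _
  have hLle : (L : ℝ) ≤ (lam + 1) * Real.exp (A * (l₁ / l₂)) := by
    have h := (Nat.ceil_lt_add_one (show 0 ≤ lam * (n : ℝ) ^ (l₁ / l₂) by positivity)).le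
    rw [← hL, hpow] at h
    have := Real.one_le_exp (show 0 ≤ A * (l₁ / l₂) by positivity)
    linarith
  set s := (k : ℝ) - 7 * A * max 1 ((k : ℝ) ^ 2 / (2 * d)) with hs
  have hs0 : 0 < s := support_bound_pos hA1 hr' hd' h1 h2' hc hc2 hl2 hl2' hK1 hK2
  set t := ⌊(r : ℝ) / A⌋₊
  have ht : (t : ℝ) ≤ r / A := Nat.floor_le (by positivity)
  have hrA : 28 ≤ (r : ℝ) / A := by
    rw [le_div_iff₀ hA0]; nlinarith [mul_nonneg hA0.le (sub_nonneg.mpr hA1), sq_nonneg A]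
  have ht' : (r : ℝ) / A / 8 ≤ t := by
    have := Nat.lt_floor_add_one ((r : ℝ) / A)
    linarith
  have htr : t ≤ r := by
    have : (r : ℝ) / A ≤ r := div_le_self hr0.le hA1
    exact_mod_cast ht.trans this
  have hexp := exponent_le hA1 hr0 hd' h1 h2' hc hl1 hl2 hK1 hK2 (Nat.cast_nonneg t) ht hs
  have hlam' : (lam + 1) * Real.exp 2 ≤ r / A / 8 := by
    have hmin := min_le_left ((r : ℝ) / A) ((n : ℝ) ^ ((1 : ℝ) / 8))
    have : lam + 1 ≤ 1 / (8 * Real.exp 2) * (r / A) := by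
      have : 1 / (8 * Real.exp 2) * min ((r : ℝ) / A) ((n : ℝ) ^ ((1 : ℝ) / 8))
        ≤ 1 / (8 * Real.exp 2) * (r / A) := by gcongr
      linarith
    calc (lam + 1) * Real.exp 2 ≤ 1 / (8 * Real.exp 2) * (r / A) * Real.exp 2 := by gcongr
      _ = r / A / 8 := by field_simp
  have : Nonempty (Fin d) := ⟨⟨0, hd⟩⟩
  obtain ⟨S, hS, hit⟩ := exists_hitting_set (fun j => Finset.image (G j) Finset.univ) s hs0 hG
    (r - t) t (by
      rw [Fintype.card_fin, Fintype.card_fin, Nat.cast_sub htr]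
      calc (L : ℝ) * Real.exp (-(s / d) * (r - t))
          ≤ (lam + 1) * Real.exp (A * (l₁ / l₂)) * Real.exp (-(s / d) * (r - t)) := by gcongr
        _ = (lam + 1) * Real.exp (A * (l₁ / l₂) + -(s / d) * (r - t)) := by
            rw [mul_assoc, ← Real.exp_add]
        _ ≤ (lam + 1) * Real.exp 2 := by gcongr; linarith
        _ ≤ t := hlam'.trans ht')
  exact exists_no_collision_of_hitting z G S (by omega) hit
end

section
/- Let n and d be positive integers with d ≥ 48·ln n, and let P(1), …, P(n) be n points sampled independently and uniformly at random from the d-dimensional Hamming cube {0,1}^d. Then with probability at least 1 − 1/n, every two of these points are at Hamming distance at least d/4 from each other; that is, the probability that there exist indices i ≠ j with dist(P(i), P(j)) < d/4 is at most 1/n. -/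
/-- For a uniformly random bit string `q` and distinct positions `i`, `j`, the average of
`exp (-[q i ≠ q j])` is `(1 + exp (-1)) / 2`. -/
theorem sum_exp_neg_ne {ι : Type*} [Fintype ι] [DecidableEq ι] {i j : ι} (hij : i ≠ j) :
    ∑ q : ι → Bool, (if q i ≠ q j then Real.exp (-1) else 1)
      = 2 ^ Fintype.card ι * ((1 + Real.exp (-1)) / 2) := by
  have hinv : Function.Involutive
      (fun q : ι → Bool => Function.update q i (!q i)) := fun q => by simp
  have hflip := Equiv.sum_comp (hinv.toPerm _)
    (fun q : ι → Bool => if q i ≠ q j then Real.exp (-1) else 1)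
  have hadd : ∑ q : ι → Bool, ((if q i ≠ q j then Real.exp (-1) else 1)
      + (if (hinv.toPerm _ q) i ≠ (hinv.toPerm _ q) j then Real.exp (-1) else 1))
      = ∑ _q : ι → Bool, (1 + Real.exp (-1)) := by
    refine Finset.sum_congr rfl fun q _ => ?_
    cases hi : q i <;> cases hj : q j <;> simp [hi, hj, hij.symm, add_comm]
  rw [Finset.sum_add_distrib, hflip] at hadd
  simp only [Finset.sum_const, Finset.card_univ, Fintype.card_fun, Fintype.card_bool,
    nsmul_eq_mul, Nat.cast_pow, Nat.cast_ofNat] at hadd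
  linarith

/-- The moment generating function at `-1` of the Hamming distance of two distinct rows of a
random bit matrix, in unnormalized form. -/
theorem sum_exp_neg_hammingDist {ι κ : Type*} [Fintype ι] [DecidableEq ι] [Fintype κ]
    [DecidableEq κ] {i j : ι} (hij : i ≠ j) :
    ∑ P : ι → κ → Bool, Real.exp (-(hammingDist (P i) (P j) : ℝ))
      = Fintype.card (ι → κ → Bool) * ((1 + Real.exp (-1)) / 2) ^ Fintype.card κ := by
  have hprod (P : ι → κ → Bool) : Real.exp (-(hammingDist (P i) (P j) : ℝ))
      = ∏ k, (if P i k ≠ P j k then Real.exp (-1) else 1) := by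
    rw [Finset.prod_ite, Finset.prod_const, Finset.prod_const_one, mul_one, ← Real.exp_nat_mul,
      mul_neg_one, hammingDist]
  have hswap := Equiv.sum_comp (Equiv.piComm fun (_ : ι) (_ : κ) => Bool)
    (fun Q : κ → ι → Bool => ∏ k, (if Q k i ≠ Q k j then Real.exp (-1) else 1))
  simp only [Equiv.piComm_apply, Function.swap] at hswap
  simp_rw [hprod]
  rw [hswap, ← Fintype.prod_sum fun (_ : κ) (q : ι → Bool) =>
      if q i ≠ q j then Real.exp (-1) else (1 : ℝ),
    Finset.prod_const, sum_exp_neg_ne hij, mul_pow, Finset.card_univ]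
  congr 1
  simp [← pow_mul, mul_comm]

/-- Chernoff bound for the Hamming distance of two distinct rows of a random bit matrix. -/
theorem card_hammingDist_lt_le {ι κ : Type*} [Fintype ι] [DecidableEq ι] [Fintype κ]
    [DecidableEq κ] {i j : ι} (hij : i ≠ j) :
    ((Finset.univ.filter fun P : ι → κ → Bool =>
        (hammingDist (P i) (P j) : ℝ) < (Fintype.card κ : ℝ) / 4).card : ℝ)
      ≤ Fintype.card (ι → κ → Bool) * Real.exp (-(Fintype.card κ : ℝ) / 16) := by
  set d := Fintype.card κ
  have hbase : (1 + Real.exp (-1)) / 2 ≤ Real.exp (-(5 / 16)) := by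
    have h1 := Real.add_one_le_exp (-(5 / 16) : ℝ)
    have h2 := Real.exp_neg_one_lt_d9
    linarith
  calc _ = ∑ P : ι → κ → Bool, if (hammingDist (P i) (P j) : ℝ) < (d : ℝ) / 4 then (1 : ℝ) else 0 :=
        by rw [Finset.sum_boole]
    _ ≤ ∑ P : ι → κ → Bool,
          Real.exp ((d : ℝ) / 4) * Real.exp (-(hammingDist (P i) (P j) : ℝ)) := by
        refine Finset.sum_le_sum fun P _ => ?_
        split_ifs with hP
        · rw [← Real.exp_add]
          exact Real.one_le_exp (by linarith)
        · positivity
    _ = Real.exp ((d : ℝ) / 4)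
          * (Fintype.card (ι → κ → Bool) * ((1 + Real.exp (-1)) / 2) ^ d) := by
        rw [← Finset.mul_sum, sum_exp_neg_hammingDist hij]
    _ ≤ Real.exp ((d : ℝ) / 4)
          * (Fintype.card (ι → κ → Bool) * Real.exp (-(5 / 16)) ^ d) := by
        gcongr
    _ = Fintype.card (ι → κ → Bool) * Real.exp (-(d : ℝ) / 16) := by
        rw [← Real.exp_nat_mul, mul_left_comm, ← Real.exp_add]
        ring_nf


/-- Lemma A.7 of the paper: for `n` points sampled independently and uniformly at random
from the `d`-dimensional Hamming cube with `d ≥ 48·ln n`, the probability that some two of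
them are at Hamming distance less than `d/4` is at most `1/n`. -/
theorem random_points_separated (n d : ℕ) (hn : 0 < n) (hd : 0 < d)
    (h : 48 * Real.log n ≤ (d : ℝ)) :
    ((Finset.univ.filter (fun P : Fin n → Fin d → Bool =>
          ∃ i j : Fin n, i ≠ j ∧ (hammingDist (P i) (P j) : ℝ) < (d : ℝ) / 4)).card : ℝ)
        / (Fintype.card (Fin n → Fin d → Bool) : ℝ)
      ≤ 1 / n := by
  have hn' : (0 : ℝ) < n := by exact_mod_cast hn
  have hexp : Real.exp (-(d : ℝ) / 16) ≤ ((n : ℝ) ^ 3)⁻¹ := by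
    rw [← Real.exp_log (by positivity : (0 : ℝ) < ((n : ℝ) ^ 3)⁻¹), Real.log_inv, Real.log_pow]
    apply Real.exp_le_exp.mpr
    push_cast
    linarith
  set N : ℝ := (Fintype.card (Fin n → Fin d → Bool) : ℝ) with hN
  have hNpos : 0 < N := by
    rw [hN]
    exact_mod_cast Fintype.card_pos
  have hsub : (Finset.univ.filter (fun P : Fin n → Fin d → Bool =>
      ∃ i j : Fin n, i ≠ j ∧ (hammingDist (P i) (P j) : ℝ) < (d : ℝ) / 4))
      ⊆ (Finset.univ : Finset (Fin n)).offDiag.biUnion fun x => Finset.univ.filter fun P =>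
        (hammingDist (P x.1) (P x.2) : ℝ) < (d : ℝ) / 4 := by
    intro P hP
    obtain ⟨i, j, hij, hlt⟩ := (Finset.mem_filter.mp hP).2
    exact Finset.mem_biUnion.mpr ⟨(i, j), by simpa using hij, by simpa using hlt⟩
  rw [div_le_iff₀ hNpos]
  calc _ ≤ ∑ x ∈ (Finset.univ : Finset (Fin n)).offDiag,
          ((Finset.univ.filter fun P : Fin n → Fin d → Bool =>
            (hammingDist (P x.1) (P x.2) : ℝ) < (d : ℝ) / 4).card : ℝ) := by
        exact_mod_cast (Finset.card_le_card hsub).trans Finset.card_biUnion_le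
    _ ≤ ∑ _x ∈ (Finset.univ : Finset (Fin n)).offDiag, N * ((n : ℝ) ^ 3)⁻¹ := by
        refine Finset.sum_le_sum fun x hx => ?_
        have hx' := card_hammingDist_lt_le (κ := Fin d) (Finset.mem_offDiag.mp hx).2.2
        rw [Fintype.card_fin d] at hx'
        exact hx'.trans (by gcongr)
    _ ≤ (n : ℝ) ^ 2 * (N * ((n : ℝ) ^ 3)⁻¹) := by
        rw [Finset.sum_const, nsmul_eq_mul]
        gcongr
        rw [Finset.offDiag_card, Finset.card_univ, Fintype.card_fin, ← Nat.cast_pow, sq]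
        exact_mod_cast Nat.sub_le _ _
    _ = 1 / n * N := by field_simp
end

section
/- Let d and r be positive integers and c ≥ 1 a real number such that c·r is an integer with r ≤ c·r ≤ d. Let q and z be points of the d-dimensional Hamming cube with a := dist(q, z) ≤ r, let I = {i : q i = z i} (so |I| = d − a), and let T ⊆ I with |T| = m. Let S be a uniformly random subset of I of size c·r − a, and let q′ be obtained from q by flipping the coordinates in S (so that dist(q′, z) = c·r and q′ differs from z on every coordinate where q does). Then the probability that S is disjoint from T (equivalently, that q′ agrees with z on every coordinate of T) is at most (1 − m/d)^((c−1)·r). -/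
theorem sub_descFactorial_mul_pow_le {n d m : ℕ} (hnd : n ≤ d) (hmn : m ≤ n) (k : ℕ) :
    (n - m).descFactorial k * d ^ k ≤ n.descFactorial k * (d - m) ^ k := by
  induction k with
  | zero => simp
  | succ k ih =>
    have step : (n - m - k) * d ≤ (n - k) * (d - m) := by
      rcases le_total (m + k) n with h | h
      · obtain ⟨t, rfl⟩ := Nat.exists_eq_add_of_le h
        obtain ⟨u, rfl⟩ := Nat.exists_eq_add_of_le hnd
        have e₁ : m + k + t - m - k = t := by omega
        have e₂ : m + k + t - k = m + t := by omega
        have e₃ : m + k + t + u - m = k + t + u := by omega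
        rw [e₁, e₂, e₃]
        nlinarith [Nat.zero_le (m * k), Nat.zero_le (m * u)]
      · have e : n - m - k = 0 := by omega
        simp [e]
    rw [Nat.descFactorial_succ, Nat.descFactorial_succ, pow_succ, pow_succ]
    calc (n - m - k) * (n - m).descFactorial k * (d ^ k * d)
        = ((n - m - k) * d) * ((n - m).descFactorial k * d ^ k) := by ring
      _ ≤ ((n - k) * (d - m)) * (n.descFactorial k * (d - m) ^ k) := Nat.mul_le_mul step ih
      _ = (n - k) * n.descFactorial k * ((d - m) ^ k * (d - m)) := by ring

theorem sub_choose_mul_pow_le {n d m : ℕ} (hnd : n ≤ d) (hmn : m ≤ n) (k : ℕ) :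
    (n - m).choose k * d ^ k ≤ n.choose k * (d - m) ^ k := by
  have h := sub_descFactorial_mul_pow_le hnd hmn k
  rw [Nat.descFactorial_eq_factorial_mul_choose, Nat.descFactorial_eq_factorial_mul_choose,
    mul_assoc, mul_assoc] at h
  exact Nat.le_of_mul_le_mul_left h k.factorial_pos

theorem sub_choose_div_choose_le {n d m k : ℕ} (hd : 0 < d) (hnd : n ≤ d) (hmn : m ≤ n)
    (hkn : k ≤ n) :
    ((n - m).choose k : ℝ) / (n.choose k : ℝ) ≤ (1 - (m : ℝ) / d) ^ k := by
  have hd' : (0 : ℝ) < d := by exact_mod_cast hd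
  have hC : (0 : ℝ) < n.choose k := by exact_mod_cast Nat.choose_pos hkn
  have h : ((n - m).choose k : ℝ) * (d : ℝ) ^ k ≤ n.choose k * ((d : ℝ) - m) ^ k := by
    rw [← Nat.cast_sub (hmn.trans hnd)]
    exact_mod_cast sub_choose_mul_pow_le hnd hmn k
  rw [one_sub_div hd'.ne', div_pow, div_le_div_iff₀ hC (by positivity)]
  linarith

theorem card_filter_disjoint_powersetCard {α : Type*} [DecidableEq α] {I T : Finset α}
    (hTI : T ⊆ I) (k : ℕ) :
    ((I.powersetCard k).filter (fun S => Disjoint S T)).card = (I.card - T.card).choose k := by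
  have h : (I.powersetCard k).filter (fun S => Disjoint S T) = (I \ T).powersetCard k := by
    ext S
    simp only [Finset.mem_filter, Finset.mem_powersetCard, Finset.subset_sdiff]
    tauto
  rw [h, Finset.card_powersetCard, Finset.card_sdiff_of_subset hTI]

theorem card_filter_eq_add_hammingDist {ι β : Type*} [Fintype ι] [DecidableEq β] (q z : ι → β) :
    (Finset.univ.filter (fun i => q i = z i)).card + hammingDist q z = Fintype.card ι :=
  Finset.card_filter_add_card_filter_not (s := Finset.univ) (fun i => q i = z i)

/-- Single-hash-function estimate in the proof of Lemma 4.4: with `a = dist(q, z) ≤ r`,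
`I = {i : q i = z i}`, `T ⊆ I` of size `m`, and `S` a uniformly random subset of `I` of
size `c·r − a`, the probability that `S` is disjoint from `T` is at most
`(1 − m/d)^((c−1)·r)`. -/
theorem flip_avoids_support (d r cr m : ℕ) (hd : 0 < d) (hr : 0 < r)
    (c : ℝ) (hc : 1 ≤ c) (hcrval : (cr : ℝ) = c * r) (hrcr : r ≤ cr) (hcrd : cr ≤ d)
    (q z : Fin d → Bool) (ha : hammingDist q z ≤ r)
    (T : Finset (Fin d)) (hTI : ∀ i ∈ T, q i = z i) (hTm : T.card = m) :
    ((((Finset.univ.filter (fun i : Fin d => q i = z i)).powersetCard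
          (cr - hammingDist q z)).filter (fun S => Disjoint S T)).card : ℝ)
        / (((Finset.univ.filter (fun i : Fin d => q i = z i)).powersetCard
          (cr - hammingDist q z)).card : ℝ)
      ≤ (1 - (m : ℝ) / d) ^ ((c - 1) * (r : ℝ)) := by
  have hTsub : T ⊆ Finset.univ.filter (fun i : Fin d => q i = z i) := fun i hi => by
    simpa using hTI i hi
  have hI := card_filter_eq_add_hammingDist q z
  rw [Fintype.card_fin] at hI
  have hmn := Finset.card_le_card hTsub
  rw [card_filter_disjoint_powersetCard hTsub, Finset.card_powersetCard, hTm]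
  rw [hTm] at hmn
  have hexp : (c - 1) * (r : ℝ) = ((cr - r : ℕ) : ℝ) := by
    rw [Nat.cast_sub hrcr, hcrval]; ring
  rw [hexp, Real.rpow_natCast]
  have hmd : (m : ℝ) ≤ d := by exact_mod_cast (by omega : m ≤ d)
  refine (sub_choose_div_choose_le hd (by omega) hmn (by omega)).trans
    (pow_le_pow_of_le_one ?_ ?_ (by omega))
  · exact sub_nonneg.2 (div_le_one_of_le₀ hmd (by positivity))
  · exact sub_le_self _ (by positivity)
end
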